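/- arXiv:2507.01317 — 2 statements merged into one kernel-verified Lean document; each statement's English description precedes it below -/
import Mathlib

section
/- Let d ≥ 2, let E₀ be a Schwartz function on ℝ^d, and let E(t) = e^{itΔ}E₀ be its free Schrödinger evolution, so that i∂_tE + ΔE = 0. Writing x = (x₁, y) ∈ ℝ × ℝ^{d−1}, for every t ∈ ℝ and every x₁ ∈ ℝ the following two identities hold: (i) ∂_t ∫_{ℝ^{d−1}} |E(t,x₁,y)|²/2 dy = ∂_{x₁} ∫_{ℝ^{d−1}} Im( E(t,x₁,y) · conj(∂_{x₁}E(t,x₁,y)) ) dy; (ii) ∂_t ∫_{ℝ^{d−1}} Im( E(t,x₁,y) · conj(∂_{x₁}E(t,x₁,y)) ) dy = ∂_{x₁} ∫_{ℝ^{d−1}} ( 2|∂_{x₁}E(t,x₁,y)|² − ∂²_{x₁}( |E(t,x₁,y)|²/2 ) ) dy. -/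
open MeasureTheory

noncomputable section

/-- The dot product on `ℝ^d = ℝ × ℝ^{d-1}`. -/
def dotp {k : ℕ} (x ξ : ℝ × (Fin k → ℝ)) : ℝ := x.1 * ξ.1 + ∑ i, x.2 i * ξ.2 i

/-- The squared Euclidean norm on `ℝ^d = ℝ × ℝ^{d-1}`. -/
def nsq {k : ℕ} (ξ : ℝ × (Fin k → ℝ)) : ℝ := ξ.1 ^ 2 + ∑ i, ξ.2 i ^ 2

/-- The Fourier transform `û(ξ) = ∫ e^{-i x·ξ} u(x) dx`. -/
def FT {k : ℕ} (u : (ℝ × (Fin k → ℝ)) → ℂ) (ξ : ℝ × (Fin k → ℝ)) : ℂ :=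
  ∫ x : ℝ × (Fin k → ℝ), Complex.exp (-Complex.I * (dotp x ξ : ℂ)) * u x

/-- The free Schrödinger evolution `e^{itΔ}u₀`, i.e. the function whose spatial Fourier
transform is `e^{-it|ξ|²} û₀(ξ)`. -/
def schrodingerEvol {k : ℕ} (u₀ : (ℝ × (Fin k → ℝ)) → ℂ) (t : ℝ)
    (x : ℝ × (Fin k → ℝ)) : ℂ :=
  ((2 * Real.pi) ^ (k + 1) : ℝ)⁻¹ •
    ∫ ξ : ℝ × (Fin k → ℝ),
      Complex.exp (Complex.I * (dotp x ξ : ℂ) - Complex.I * (t : ℂ) * (nsq ξ : ℂ)) * FT u₀ ξ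

open scoped FourierTransform LineDeriv SchwartzMap

section DotProduct

variable {k : ℕ}

lemma continuous_dotp :
    Continuous fun p : (ℝ × (Fin k → ℝ)) × (ℝ × (Fin k → ℝ)) => dotp p.1 p.2 := by
  unfold dotp
  fun_prop

lemma continuous_nsq : Continuous (nsq : ℝ × (Fin k → ℝ) → ℝ) := by
  unfold nsq
  fun_prop

lemma dotp_add_left (x y ξ : ℝ × (Fin k → ℝ)) : dotp (x + y) ξ = dotp x ξ + dotp y ξ := by
  simp only [dotp, Prod.fst_add, Prod.snd_add, Pi.add_apply, add_mul, Finset.sum_add_distrib]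
  ring

lemma dotp_smul_left (c : ℝ) (x ξ : ℝ × (Fin k → ℝ)) : dotp (c • x) ξ = c * dotp x ξ := by
  simp only [dotp, Prod.smul_fst, Prod.smul_snd, Pi.smul_apply, smul_eq_mul, mul_add,
    Finset.mul_sum, mul_assoc]

lemma dotp_comm (x y : ℝ × (Fin k → ℝ)) : dotp x y = dotp y x := by
  simp only [dotp, mul_comm]

lemma nsq_eq_dotp (x : ℝ × (Fin k → ℝ)) : nsq x = dotp x x := by
  simp only [nsq, dotp, sq]

lemma dotp_fst_basis (x : ℝ × (Fin k → ℝ)) : dotp ((1, 0) : ℝ × (Fin k → ℝ)) x = x.1 := by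
  simp [dotp]

lemma dotp_snd_basis (j : Fin k) (x : ℝ × (Fin k → ℝ)) :
    dotp ((0, Pi.single j 1) : ℝ × (Fin k → ℝ)) x = x.2 j := by
  simp [dotp, Pi.single_apply]

lemma nsq_eq_sum_dotp_sq (x : ℝ × (Fin k → ℝ)) :
    nsq x = dotp (1, 0) x ^ 2 + ∑ j, dotp (0, Pi.single j 1) x ^ 2 := by
  simp only [nsq, dotp_fst_basis, dotp_snd_basis]

end DotProduct

section FourierTransform

variable {k : ℕ}

/-- The identification of `ℝ × (Fin k → ℝ)` with a Euclidean space. -/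
def euclideanProdEquiv (k : ℕ) :
    (ℝ × (Fin k → ℝ)) ≃L[ℝ] WithLp 2 (ℝ × EuclideanSpace ℝ (Fin k)) :=
  ((ContinuousLinearEquiv.refl ℝ ℝ).prodCongr (EuclideanSpace.equiv (Fin k) ℝ).symm).trans
    (WithLp.prodContinuousLinearEquiv 2 ℝ ℝ (EuclideanSpace ℝ (Fin k))).symm

lemma inner_euclideanProdEquiv (x ξ : ℝ × (Fin k → ℝ)) :
    inner ℝ (euclideanProdEquiv k x) (euclideanProdEquiv k ξ) = dotp x ξ := by
  simp [euclideanProdEquiv, dotp, WithLp.prod_inner_apply, PiLp.inner_apply, mul_comm]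

lemma measurePreserving_euclideanProdEquiv :
    MeasurePreserving (euclideanProdEquiv k) := by
  exact (WithLp.volume_preserving_toLp ℝ (EuclideanSpace ℝ (Fin k))).comp
    ((MeasurePreserving.id volume).prod (PiLp.volume_preserving_toLp (Fin k)))

lemma exists_schwartzMap_eq_FT (u : 𝓢(ℝ × (Fin k → ℝ), ℂ)) :
    ∃ g : 𝓢(ℝ × (Fin k → ℝ), ℂ), ⇑g = FT u := by
  have hpi : (2 * Real.pi)⁻¹ ≠ 0 := by positivity
  let A := euclideanProdEquiv k
  let B := (ContinuousLinearEquiv.smulLeft (Units.mk0 (2 * Real.pi)⁻¹ hpi)).trans A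
  refine ⟨SchwartzMap.compCLMOfContinuousLinearEquiv ℂ B
    (𝓕 (SchwartzMap.compCLMOfContinuousLinearEquiv ℂ A.symm u)), ?_⟩
  ext ξ
  simp only [SchwartzMap.compCLMOfContinuousLinearEquiv_apply, Function.comp_apply,
    SchwartzMap.fourier_coe, Real.fourier_eq', FT]
  rw [← measurePreserving_euclideanProdEquiv.integral_comp
    A.toHomeomorph.measurableEmbedding]
  refine integral_congr_ae (.of_forall fun x => ?_)
  have hB : B ξ = (2 * Real.pi)⁻¹ • A ξ :=
    map_smul A _ _
  simp only [hB, inner_smul_right, A, inner_euclideanProdEquiv, smul_eq_mul,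
    ContinuousLinearEquiv.symm_apply_apply]
  congr 2
  push_cast
  field_simp

end FourierTransform

section WavePacket

variable {k : ℕ}

instance isAddHaarMeasure_volume_prod_pi :
    (volume : Measure (ℝ × (Fin k → ℝ))).IsAddHaarMeasure :=
  inferInstanceAs ((volume : Measure ℝ).prod (volume : Measure (Fin k → ℝ))).IsAddHaarMeasure

/-- The plane wave `e^{i x·ξ - i t |ξ|²}`. -/
def planeWave (t : ℝ) (x ξ : ℝ × (Fin k → ℝ)) : ℂ :=
  Complex.exp (Complex.I * (dotp x ξ : ℂ) - Complex.I * (t : ℂ) * (nsq ξ : ℂ))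

lemma norm_planeWave (t : ℝ) (x ξ : ℝ × (Fin k → ℝ)) : ‖planeWave t x ξ‖ = 1 := by
  have h : Complex.I * (dotp x ξ : ℂ) - Complex.I * (t : ℂ) * (nsq ξ : ℂ) =
      ((dotp x ξ - t * nsq ξ : ℝ) : ℂ) * Complex.I := by
    push_cast
    ring
  rw [planeWave, h, Complex.norm_exp_ofReal_mul_I]

lemma continuous_planeWave :
    Continuous fun p : (ℝ × (ℝ × (Fin k → ℝ))) × (ℝ × (Fin k → ℝ)) =>
      planeWave p.1.1 p.1.2 p.2 := by
  have h1 : Continuous fun p : (ℝ × (ℝ × (Fin k → ℝ))) × (ℝ × (Fin k → ℝ)) =>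
      dotp p.1.2 p.2 :=
    continuous_dotp.comp ((continuous_snd.comp continuous_fst).prodMk continuous_snd)
  have h2 : Continuous fun p : (ℝ × (ℝ × (Fin k → ℝ))) × (ℝ × (Fin k → ℝ)) => nsq p.2 :=
    continuous_nsq.comp continuous_snd
  unfold planeWave
  fun_prop

/-- The superposition `∫ e^{i x·ξ - i t |ξ|²} g(ξ) dξ` of plane waves. -/
def wavePacket (g : 𝓢(ℝ × (Fin k → ℝ), ℂ)) (t : ℝ) (x : ℝ × (Fin k → ℝ)) : ℂ :=
  ∫ ξ, planeWave t x ξ * g ξ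

lemma continuous_planeWave_mul (g : 𝓢(ℝ × (Fin k → ℝ), ℂ)) (t : ℝ) (x : ℝ × (Fin k → ℝ)) :
    Continuous fun ξ => planeWave t x ξ * g ξ :=
  (continuous_planeWave.comp (continuous_const (y := (t, x)) |>.prodMk continuous_id)).mul
    g.continuous

lemma integrable_planeWave_mul (g : 𝓢(ℝ × (Fin k → ℝ), ℂ)) (t : ℝ) (x : ℝ × (Fin k → ℝ)) :
    Integrable fun ξ => planeWave t x ξ * g ξ :=
  g.integrable.mono (continuous_planeWave_mul g t x).aestronglyMeasurable
    (.of_forall fun ξ => by simp [norm_planeWave])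

lemma norm_wavePacket_le (g : 𝓢(ℝ × (Fin k → ℝ), ℂ)) (t : ℝ) (x : ℝ × (Fin k → ℝ)) :
    ‖wavePacket g t x‖ ≤ ∫ ξ, ‖g ξ‖ :=
  norm_integral_le_of_norm_le g.integrable.norm (.of_forall fun ξ => by simp [norm_planeWave])

lemma continuous_wavePacket (g : 𝓢(ℝ × (Fin k → ℝ), ℂ)) (t : ℝ) :
    Continuous (wavePacket g t) :=
  continuous_of_dominated (fun x => (continuous_planeWave_mul g t x).aestronglyMeasurable)
    (fun x => .of_forall fun ξ => by simp [norm_planeWave] : ∀ x, ∀ᵐ ξ, _ ≤ ‖g ξ‖)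
    g.integrable.norm
    (.of_forall fun ξ => (continuous_planeWave.comp
      ((continuous_const.prodMk continuous_id).prodMk continuous_const)).mul continuous_const)

/-- The Fourier multiplier of the space-time derivative `τ ∂ₜ + e·∇` acting on solutions of the
free Schrödinger equation. -/
def derivSymbol (τ : ℝ) (e ξ : ℝ × (Fin k → ℝ)) : ℂ :=
  Complex.I * (dotp e ξ : ℂ) - Complex.I * (τ : ℂ) * (nsq ξ : ℂ)

lemma hasTemperateGrowth_derivSymbol (τ : ℝ) (e : ℝ × (Fin k → ℝ)) :
    (derivSymbol τ e).HasTemperateGrowth := by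
  have hd : ∀ e : ℝ × (Fin k → ℝ), (fun ξ => (dotp e ξ : ℂ)).HasTemperateGrowth := by
    intro e
    let ℓ : (ℝ × (Fin k → ℝ)) →ₗ[ℝ] ℝ :=
      { toFun := fun ξ => dotp e ξ
        map_add' := fun x y => by simp only [dotp_comm e, dotp_add_left]
        map_smul' := fun c x => by simp only [dotp_comm e, dotp_smul_left]; rfl }
    exact (Complex.ofRealCLM.comp ℓ.toContinuousLinearMap).hasTemperateGrowth
  have hn : (fun ξ : ℝ × (Fin k → ℝ) => (nsq ξ : ℂ)).HasTemperateGrowth := by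
    simp only [nsq_eq_sum_dotp_sq]
    push_cast
    exact ((hd _).pow 2).add (.sum fun j _ => (hd _).pow 2)
  exact ((Function.HasTemperateGrowth.const _).mul (hd e)).sub
    ((Function.HasTemperateGrowth.const (Complex.I * (τ : ℂ))).mul hn)

/-- Multiplication by `derivSymbol`. -/
def derivMul (τ : ℝ) (e : ℝ × (Fin k → ℝ)) (g : 𝓢(ℝ × (Fin k → ℝ), ℂ)) :
    𝓢(ℝ × (Fin k → ℝ), ℂ) :=
  SchwartzMap.smulLeftCLM ℂ (derivSymbol τ e) g

lemma derivMul_apply (τ : ℝ) (e : ℝ × (Fin k → ℝ)) (g : 𝓢(ℝ × (Fin k → ℝ), ℂ))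
    (ξ : ℝ × (Fin k → ℝ)) : derivMul τ e g ξ = derivSymbol τ e ξ * g ξ :=
  SchwartzMap.smulLeftCLM_apply_apply (hasTemperateGrowth_derivSymbol τ e) g ξ

lemma hasDerivAt_planeWave (t τ s : ℝ) (x e ξ : ℝ × (Fin k → ℝ)) :
    HasDerivAt (fun s : ℝ => planeWave (t + s * τ) (x + s • e) ξ)
      (planeWave (t + s * τ) (x + s • e) ξ * derivSymbol τ e ξ) s := by
  have h : HasDerivAt (fun s : ℝ => Complex.I * (dotp x ξ + s * dotp e ξ) -
      Complex.I * (t + s * τ) * nsq ξ) (derivSymbol τ e ξ) s := by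
    have hs : HasDerivAt (fun s : ℝ => (s : ℂ)) 1 s := Complex.ofRealCLM.hasDerivAt
    have := (((hs.mul_const (dotp e ξ : ℂ)).const_add (dotp x ξ : ℂ)).const_mul Complex.I).sub
      ((((hs.mul_const (τ : ℂ)).const_add (t : ℂ)).const_mul Complex.I).mul_const (nsq ξ : ℂ))
    simpa only [one_mul] using! this
  simpa only [planeWave, dotp_add_left, dotp_smul_left, Complex.ofReal_add, Complex.ofReal_mul]
    using h.cexp

lemma hasDerivAt_wavePacket (g : 𝓢(ℝ × (Fin k → ℝ), ℂ)) (t τ s : ℝ)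
    (x e : ℝ × (Fin k → ℝ)) :
    HasDerivAt (fun s : ℝ => wavePacket g (t + s * τ) (x + s • e))
      (wavePacket (derivMul τ e g) (t + s * τ) (x + s • e)) s := by
  refine (hasDerivAt_integral_of_dominated_loc_of_deriv_le (μ := volume) Filter.univ_mem
    (F := fun (s : ℝ) ξ => planeWave (t + s * τ) (x + s • e) ξ * g ξ)
    (F' := fun (s : ℝ) ξ => planeWave (t + s * τ) (x + s • e) ξ * derivMul τ e g ξ)
    (bound := fun ξ => ‖derivMul τ e g ξ‖)
    (.of_forall fun s => (continuous_planeWave_mul g _ _).aestronglyMeasurable)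
    (integrable_planeWave_mul g _ _)
    (continuous_planeWave_mul _ _ _).aestronglyMeasurable
    (.of_forall fun ξ s _ => by simp [norm_planeWave])
    (derivMul τ e g).integrable.norm (.of_forall fun ξ s _ => ?_)).2
  simpa only [derivMul_apply, mul_assoc] using (hasDerivAt_planeWave t τ s x e ξ).mul_const (g ξ)

lemma hasDerivAt_planeWave_frequency (t s : ℝ) (x e ξ : ℝ × (Fin k → ℝ)) :
    HasDerivAt (fun s : ℝ => planeWave t x (ξ + s • e))
      (planeWave t x (ξ + s • e) *
        (Complex.I * (dotp x e - 2 * t * dotp e (ξ + s • e)))) s := by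
  have hs : HasDerivAt (fun s : ℝ => (s : ℂ)) 1 s := Complex.ofRealCLM.hasDerivAt
  have h : HasDerivAt (fun s : ℝ => Complex.I * (dotp x ξ + s * dotp x e) -
      Complex.I * t * (dotp ξ ξ + s * (2 * dotp e ξ) + s ^ 2 * dotp e e))
      (Complex.I * (dotp x e - 2 * t * dotp e (ξ + s • e))) s := by
    have := (((hs.mul_const (dotp x e : ℂ)).const_add (dotp x ξ : ℂ)).const_mul Complex.I).sub
      (((((hs.mul_const (2 * dotp e ξ : ℂ)).const_add (dotp ξ ξ : ℂ)).add
        ((hs.pow 2).mul_const (dotp e e : ℂ))).const_mul (Complex.I * t)))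
    convert! this using 1
    rw [dotp_comm e, dotp_add_left, dotp_smul_left, dotp_comm ξ e]
    push_cast
    ring
  have hx : ∀ s : ℝ, dotp x (ξ + s • e) = dotp x ξ + s * dotp x e := fun s => by
    simp only [dotp_comm x, dotp_add_left, dotp_smul_left]
  have hn : ∀ s : ℝ, nsq (ξ + s • e) =
      dotp ξ ξ + s * (2 * dotp e ξ) + s ^ 2 * dotp e e := fun s => by
    rw [nsq_eq_dotp, dotp_add_left, dotp_smul_left, dotp_comm ξ, dotp_comm e, dotp_add_left,
      dotp_add_left, dotp_smul_left, dotp_smul_left, dotp_comm ξ e]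
    ring
  convert! h.cexp using 1
  · ext s
    simp only [planeWave, hx, hn]
    congr 1
    push_cast
    ring
  · simp only [planeWave, hx, hn]
    congr 2
    push_cast
    ring

lemma dotp_mul_wavePacket (g : 𝓢(ℝ × (Fin k → ℝ), ℂ)) (t : ℝ) (x e : ℝ × (Fin k → ℝ)) :
    (dotp x e : ℂ) * wavePacket g t x =
      Complex.I * wavePacket (∂_{e} g) t x -
        2 * t * Complex.I * wavePacket (derivMul 0 e g) t x := by
  have hI := Complex.I_mul_I
  have key : ∀ ξ, planeWave t x ξ * (Complex.I * (dotp x e - 2 * t * dotp e ξ)) * g ξ =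
      Complex.I * dotp x e * (planeWave t x ξ * g ξ) -
        2 * t * (planeWave t x ξ * derivMul 0 e g ξ) := by
    intro ξ
    simp only [derivMul_apply, derivSymbol]
    push_cast
    ring
  have ibp := integral_bilinear_hasLineDerivAt_right_eq_neg_left_of_integrable
    (μ := (volume : Measure (ℝ × (Fin k → ℝ)))) (B := ContinuousLinearMap.mul ℝ ℂ)
    (f := planeWave t x) (g := g) (v := e)
    (f' := fun ξ => planeWave t x ξ * (Complex.I * (dotp x e - 2 * t * dotp e ξ)))
    (g' := ⇑(∂_{e} g : 𝓢(ℝ × (Fin k → ℝ), ℂ))) ?_ ?_ ?_ ?_ ?_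
  · simp only [ContinuousLinearMap.mul_apply', key] at ibp
    rw [integral_sub ((integrable_planeWave_mul _ _ _).const_mul _)
      ((integrable_planeWave_mul _ _ _).const_mul _), integral_const_mul, integral_const_mul] at ibp
    simp only [wavePacket]
    rw [ibp]
    linear_combination ((dotp x e : ℂ) * ∫ ξ, planeWave t x ξ * g ξ) * hI
  · simp only [ContinuousLinearMap.mul_apply', key]
    exact ((integrable_planeWave_mul _ _ _).const_mul _).sub
      ((integrable_planeWave_mul _ _ _).const_mul _)
  · exact integrable_planeWave_mul _ _ _
  · exact integrable_planeWave_mul _ _ _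
  · intro ξ _
    simpa [HasLineDerivAt] using hasDerivAt_planeWave_frequency t 0 x e ξ
  · intro ξ _
    exact (g.differentiableAt.hasFDerivAt (x := ξ)).hasLineDerivAt e

lemma exists_norm_snd_pow_mul_wavePacket_le (N : ℕ) (T : ℝ) (g : 𝓢(ℝ × (Fin k → ℝ), ℂ)) :
    ∃ C, ∀ t, |t| ≤ T → ∀ x : ℝ × (Fin k → ℝ), ‖x.2‖ ^ N * ‖wavePacket g t x‖ ≤ C := by
  induction N generalizing g with
  | zero => exact ⟨∫ ξ, ‖g ξ‖, fun t _ x => by simpa using norm_wavePacket_le g t x⟩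
  | succ N ih =>
    choose C hC using ih
    let e : Fin k → ℝ × (Fin k → ℝ) := fun j => (0, Pi.single j 1)
    refine ⟨∑ j, (C (∂_{e j} g) + 2 * T * C (derivMul 0 (e j) g)), fun t ht x => ?_⟩
    have hT : 0 ≤ T := (abs_nonneg t).trans ht
    have hx : ‖x.2‖ ≤ ∑ j, ‖x.2 j‖ := (pi_norm_le_iff_of_nonneg (by positivity)).2 fun j =>
      Finset.single_le_sum (f := fun j => ‖x.2 j‖) (fun _ _ => norm_nonneg _) (Finset.mem_univ j)
    calc ‖x.2‖ ^ (N + 1) * ‖wavePacket g t x‖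
        = ‖x.2‖ ^ N * (‖x.2‖ * ‖wavePacket g t x‖) := by ring
      _ ≤ ‖x.2‖ ^ N * ((∑ j, ‖x.2 j‖) * ‖wavePacket g t x‖) := by gcongr
      _ = ∑ j, ‖x.2‖ ^ N * ‖(dotp x (e j) : ℂ) * wavePacket g t x‖ := by
        simp only [e, dotp_comm x, dotp_snd_basis, norm_mul, Complex.norm_real,
          Finset.sum_mul, Finset.mul_sum]
      _ ≤ _ := Finset.sum_le_sum fun j _ => ?_
    have h1 := hC (∂_{e j} g) t ht x
    have h2 := hC (derivMul 0 (e j) g) t ht x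
    rw [dotp_mul_wavePacket]
    calc _ ≤ ‖x.2‖ ^ N * (‖wavePacket (∂_{e j} g) t x‖ +
          2 * |t| * ‖wavePacket (derivMul 0 (e j) g) t x‖) := by
          gcongr
          exact (norm_sub_le _ _).trans_eq (by simp)
      _ = ‖x.2‖ ^ N * ‖wavePacket (∂_{e j} g) t x‖ +
          2 * |t| * (‖x.2‖ ^ N * ‖wavePacket (derivMul 0 (e j) g) t x‖) := by ring
      _ ≤ _ := by gcongr

lemma exists_integrable_bound_wavePacket (T : ℝ) (g : 𝓢(ℝ × (Fin k → ℝ), ℂ)) :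
    ∃ b : (Fin k → ℝ) → ℝ, Integrable b ∧
      ∀ t, |t| ≤ T → ∀ a y, ‖wavePacket g t (a, y)‖ ≤ b y := by
  obtain ⟨C, hC⟩ := exists_norm_snd_pow_mul_wavePacket_le (k + 1) T g
  obtain ⟨D, hD⟩ := exists_norm_snd_pow_mul_wavePacket_le 0 T g
  refine ⟨fun y => 2 ^ k * (D + C) * (1 + ‖y‖) ^ (-((k + 1 : ℕ) : ℝ)),
    (integrable_one_add_norm (by simp)).const_mul _, fun t ht a y => ?_⟩
  have hpos : (0 : ℝ) < (1 + ‖y‖) ^ (k + 1) := by positivity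
  beta_reduce
  rw [Real.rpow_neg (by positivity), Real.rpow_natCast, ← div_eq_mul_inv, le_div_iff₀ hpos]
  have h1 := hC t ht (a, y)
  have h0 := hD t ht (a, y)
  have h2 : (1 + ‖y‖) ^ (k + 1) ≤ 2 ^ k * (1 ^ (k + 1) + ‖y‖ ^ (k + 1)) := by
    simpa using add_pow_le zero_le_one (norm_nonneg y) (k + 1)
  calc ‖wavePacket g t (a, y)‖ * (1 + ‖y‖) ^ (k + 1)
      ≤ ‖wavePacket g t (a, y)‖ * (2 ^ k * (1 ^ (k + 1) + ‖y‖ ^ (k + 1))) := by gcongr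
    _ = 2 ^ k * (‖y‖ ^ 0 * ‖wavePacket g t (a, y)‖ +
        ‖y‖ ^ (k + 1) * ‖wavePacket g t (a, y)‖) := by ring
    _ ≤ 2 ^ k * (D + C) := by gcongr

end WavePacket

section Pairing

variable {k : ℕ}

open ComplexConjugate

/-- The hermitian pairing of two wave packets on the slice `x₁ = a` at time `t`. -/
def slicePairing (g h : 𝓢(ℝ × (Fin k → ℝ), ℂ)) (t a : ℝ) : ℂ :=
  ∫ y : Fin k → ℝ, wavePacket g t (a, y) * conj (wavePacket h t (a, y))

lemma continuous_slice_mul_conj (g h : 𝓢(ℝ × (Fin k → ℝ), ℂ)) (t a : ℝ) :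
    Continuous fun y : Fin k → ℝ => wavePacket g t (a, y) * conj (wavePacket h t (a, y)) :=
  ((continuous_wavePacket g t).comp (by fun_prop)).mul
    (Complex.continuous_conj.comp ((continuous_wavePacket h t).comp (by fun_prop)))

lemma exists_integrable_bound_mul_conj (T : ℝ) (g h : 𝓢(ℝ × (Fin k → ℝ), ℂ)) :
    ∃ b : (Fin k → ℝ) → ℝ, Integrable b ∧
      ∀ t, |t| ≤ T → ∀ a y, ‖wavePacket g t (a, y) * conj (wavePacket h t (a, y))‖ ≤ b y := by
  obtain ⟨b, hb, hg⟩ := exists_integrable_bound_wavePacket T g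
  refine ⟨fun y => b y * ∫ ξ, ‖h ξ‖, hb.mul_const _, fun t ht a y => ?_⟩
  rw [norm_mul, RCLike.norm_conj]
  exact mul_le_mul (hg t ht a y) (norm_wavePacket_le h t _) (norm_nonneg _)
    ((norm_nonneg _).trans (hg t ht a y))

lemma integrable_slice_mul_conj (g h : 𝓢(ℝ × (Fin k → ℝ), ℂ)) (t a : ℝ) :
    Integrable fun y : Fin k → ℝ => wavePacket g t (a, y) * conj (wavePacket h t (a, y)) := by
  obtain ⟨b, hb, hgh⟩ := exists_integrable_bound_mul_conj |t| g h
  exact hb.mono' (continuous_slice_mul_conj g h t a).aestronglyMeasurable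
    (.of_forall fun y => hgh t le_rfl a y)

lemma conj_slicePairing (g h : 𝓢(ℝ × (Fin k → ℝ), ℂ)) (t a : ℝ) :
    conj (slicePairing g h t a) = slicePairing h g t a := by
  simp only [slicePairing, ← integral_conj, map_mul, Complex.conj_conj, mul_comm]

lemma integral_re_eq_re_slicePairing (g h : 𝓢(ℝ × (Fin k → ℝ), ℂ)) (t a : ℝ) :
    ∫ y : Fin k → ℝ, (wavePacket g t (a, y) * conj (wavePacket h t (a, y))).re =
      (slicePairing g h t a).re :=
  integral_re (integrable_slice_mul_conj g h t a)

lemma integral_im_eq_im_slicePairing (g h : 𝓢(ℝ × (Fin k → ℝ), ℂ)) (t a : ℝ) :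
    ∫ y : Fin k → ℝ, (wavePacket g t (a, y) * conj (wavePacket h t (a, y))).im =
      (slicePairing g h t a).im :=
  integral_im (integrable_slice_mul_conj g h t a)

lemma hasDerivAt_slicePairing (g h : 𝓢(ℝ × (Fin k → ℝ), ℂ)) (t τ a α s : ℝ) :
    HasDerivAt (fun s : ℝ => slicePairing g h (t + s * τ) (a + s * α))
      (slicePairing (derivMul τ (α, 0) g) h (t + s * τ) (a + s * α) +
        slicePairing g (derivMul τ (α, 0) h) (t + s * τ) (a + s * α)) s := by
  let T : ℝ := |t| + (|s| + 1) * |τ|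
  have hT : ∀ r ∈ Metric.ball s 1, |t + r * τ| ≤ T := by
    intro r hr
    have hr' : |r| ≤ |s| + 1 := by
      rw [Metric.mem_ball, Real.dist_eq] at hr
      linarith [abs_sub_abs_le_abs_sub r s]
    calc |t + r * τ| ≤ |t| + |r| * |τ| := (abs_add_le _ _).trans_eq (by rw [abs_mul])
      _ ≤ |t| + (|s| + 1) * |τ| := by gcongr
  obtain ⟨b₁, hb₁, h₁⟩ := exists_integrable_bound_mul_conj T (derivMul τ (α, 0) g) h
  obtain ⟨b₂, hb₂, h₂⟩ := exists_integrable_bound_mul_conj T g (derivMul τ (α, 0) h)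
  have hslice : ∀ (f : 𝓢(ℝ × (Fin k → ℝ), ℂ)) (y : Fin k → ℝ) (r : ℝ),
      HasDerivAt (fun r : ℝ => wavePacket f (t + r * τ) (a + r * α, y))
        (wavePacket (derivMul τ (α, 0) f) (t + r * τ) (a + r * α, y)) r := by
    intro f y r
    simpa using hasDerivAt_wavePacket f t τ r (a, y) (α, 0)
  have := (hasDerivAt_integral_of_dominated_loc_of_deriv_le (μ := volume)
    (Metric.ball_mem_nhds s one_pos)
    (F := fun (r : ℝ) (y : Fin k → ℝ) => wavePacket g (t + r * τ) (a + r * α, y) *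
      conj (wavePacket h (t + r * τ) (a + r * α, y)))
    (F' := fun (r : ℝ) y => wavePacket (derivMul τ (α, 0) g) (t + r * τ) (a + r * α, y) *
      conj (wavePacket h (t + r * τ) (a + r * α, y)) +
      wavePacket g (t + r * τ) (a + r * α, y) *
      conj (wavePacket (derivMul τ (α, 0) h) (t + r * τ) (a + r * α, y)))
    (bound := fun y => b₁ y + b₂ y)
    (.of_forall fun r => (continuous_slice_mul_conj g h _ _).aestronglyMeasurable)
    (integrable_slice_mul_conj g h _ _)
    ((continuous_slice_mul_conj _ _ _ _).add
      (continuous_slice_mul_conj _ _ _ _)).aestronglyMeasurable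
    (.of_forall fun y r hr => norm_add_le_of_le (h₁ _ (hT r hr) _ _) (h₂ _ (hT r hr) _ _))
    (hb₁.add hb₂) (.of_forall fun y r _ => (hslice g y r).mul (hslice h y r).star)).2
  rwa [integral_add (integrable_slice_mul_conj _ _ _ _)
    (integrable_slice_mul_conj _ _ _ _)] at this

lemma slicePairing_derivMul_snd (g h : 𝓢(ℝ × (Fin k → ℝ), ℂ)) (t a : ℝ) (v : Fin k → ℝ) :
    slicePairing (derivMul 0 (0, v) g) h t a = - slicePairing g (derivMul 0 (0, v) h) t a := by
  have hslice : ∀ (f : 𝓢(ℝ × (Fin k → ℝ), ℂ)) (y : Fin k → ℝ),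
      HasDerivAt (fun r : ℝ => wavePacket f t (a, y + r • v))
        (wavePacket (derivMul 0 (0, v) f) t (a, y)) 0 := by
    intro f y
    simpa using hasDerivAt_wavePacket f t 0 0 (a, y) (0, v)
  have := integral_bilinear_hasLineDerivAt_right_eq_neg_left_of_integrable
    (μ := (volume : Measure (Fin k → ℝ))) (B := ContinuousLinearMap.mul ℝ ℂ) (v := v)
    (f := fun y => wavePacket g t (a, y)) (g := fun y => conj (wavePacket h t (a, y)))
    (f' := fun y => wavePacket (derivMul 0 (0, v) g) t (a, y))
    (g' := fun y => conj (wavePacket (derivMul 0 (0, v) h) t (a, y)))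
    (integrable_slice_mul_conj _ _ _ _) (integrable_slice_mul_conj _ _ _ _)
    (integrable_slice_mul_conj _ _ _ _) (fun y _ => hslice g y)
    (fun y _ => (hslice h y).star)
  exact (neg_eq_iff_eq_neg.2 this).symm

end Pairing

section ConservationLaws

variable {k : ℕ}

open ComplexConjugate

lemma wavePacket_add (g h : 𝓢(ℝ × (Fin k → ℝ), ℂ)) (t : ℝ) (x : ℝ × (Fin k → ℝ)) :
    wavePacket (g + h) t x = wavePacket g t x + wavePacket h t x := by
  simp only [wavePacket, add_apply, mul_add]
  exact integral_add (integrable_planeWave_mul g t x) (integrable_planeWave_mul h t x)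

lemma wavePacket_smul (c : ℂ) (g : 𝓢(ℝ × (Fin k → ℝ), ℂ)) (t : ℝ) (x : ℝ × (Fin k → ℝ)) :
    wavePacket (c • g) t x = c * wavePacket g t x := by
  simp only [smul_apply, wavePacket, smul_eq_mul, mul_left_comm _ c,
    integral_const_mul]

/-- `slicePairing` as a linear functional of its first argument. -/
def slicePairingLeft (h : 𝓢(ℝ × (Fin k → ℝ), ℂ)) (t a : ℝ) :
    𝓢(ℝ × (Fin k → ℝ), ℂ) →ₗ[ℂ] ℂ where
  toFun g := slicePairing g h t a
  map_add' g₁ g₂ := by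
    simp only [slicePairing, wavePacket_add, add_mul]
    exact integral_add (integrable_slice_mul_conj _ _ _ _) (integrable_slice_mul_conj _ _ _ _)
  map_smul' c g := by
    simp only [slicePairing, wavePacket_smul, mul_assoc, integral_const_mul]
    rfl

lemma derivMul_time_eq (g : 𝓢(ℝ × (Fin k → ℝ), ℂ)) :
    derivMul 1 0 g = Complex.I • (derivMul 0 (1, 0) (derivMul 0 (1, 0) g) +
      ∑ j, derivMul 0 (0, Pi.single j 1) (derivMul 0 (0, Pi.single j 1) g)) := by
  ext ξ
  have h0 : dotp 0 ξ = 0 := by simp [dotp]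
  simp only [smul_apply, add_apply, sum_apply, derivMul_apply,
    derivSymbol, h0, nsq_eq_sum_dotp_sq ξ, smul_eq_mul]
  push_cast
  simp only [mul_zero, zero_mul, sub_zero, ← mul_assoc, ← Finset.sum_mul]
  have : ∀ e : ℝ × (Fin k → ℝ), Complex.I * (dotp e ξ : ℂ) * Complex.I * (dotp e ξ : ℂ) =
      - (dotp e ξ : ℂ) ^ 2 := fun e => by
    linear_combination (dotp e ξ : ℂ) ^ 2 * Complex.I_mul_I
  simp only [this, Finset.sum_neg_distrib]
  ring

lemma slicePairing_derivMul_time_left (g h : 𝓢(ℝ × (Fin k → ℝ), ℂ)) (t a : ℝ) :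
    slicePairing (derivMul 1 0 g) h t a =
      Complex.I * (slicePairing (derivMul 0 (1, 0) (derivMul 0 (1, 0) g)) h t a -
        ∑ j, slicePairing (derivMul 0 (0, Pi.single j 1) g)
          (derivMul 0 (0, Pi.single j 1) h) t a) := by
  have h1 : slicePairing (derivMul 1 0 g) h t a = slicePairingLeft h t a (derivMul 1 0 g) := rfl
  rw [h1, derivMul_time_eq, map_smul, map_add, map_sum, smul_eq_mul, sub_eq_add_neg,
    ← Finset.sum_neg_distrib]
  simp only [← slicePairing_derivMul_snd]
  rfl

lemma hasDerivAt_slicePairing_time (g h : 𝓢(ℝ × (Fin k → ℝ), ℂ)) (t a : ℝ) :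
    HasDerivAt (fun t => slicePairing g h t a)
      (Complex.I * (slicePairing (derivMul 0 (1, 0) (derivMul 0 (1, 0) g)) h t a -
        slicePairing g (derivMul 0 (1, 0) (derivMul 0 (1, 0) h)) t a)) t := by
  have := hasDerivAt_slicePairing g h 0 1 a 0 t
  simp only [zero_add, mul_one, mul_zero, add_zero] at this
  convert! this using 1
  change _ = slicePairing (derivMul 1 0 g) h t a + slicePairing g (derivMul 1 0 h) t a
  rw [← conj_slicePairing (derivMul 1 0 h) g, slicePairing_derivMul_time_left,
    slicePairing_derivMul_time_left]
  simp only [map_mul, map_sub, map_sum, conj_slicePairing, Complex.conj_I]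
  ring

lemma hasDerivAt_slicePairing_fst (g h : 𝓢(ℝ × (Fin k → ℝ), ℂ)) (t a : ℝ) :
    HasDerivAt (fun a => slicePairing g h t a)
      (slicePairing (derivMul 0 (1, 0) g) h t a + slicePairing g (derivMul 0 (1, 0) h) t a) a := by
  simpa using hasDerivAt_slicePairing g h t 0 0 1 a

lemma hasDerivAt_wavePacket_fst (g : 𝓢(ℝ × (Fin k → ℝ), ℂ)) (t a : ℝ) (y : Fin k → ℝ) :
    HasDerivAt (fun b => wavePacket g t (b, y)) (wavePacket (derivMul 0 (1, 0) g) t (a, y)) a := by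
  simpa using hasDerivAt_wavePacket g t 0 a (0, y) (1, 0)

lemma re_mul_conj_self (z : ℂ) : (z * conj z).re = ‖z‖ ^ 2 := by
  rw [Complex.mul_conj, Complex.ofReal_re, Complex.normSq_eq_norm_sq]

lemma hasDerivAt_mul_conj {f₁ f₂ : ℝ → ℂ} {f₁' f₂' : ℂ} {s : ℝ} (h₁ : HasDerivAt f₁ f₁' s)
    (h₂ : HasDerivAt f₂ f₂' s) :
    HasDerivAt (fun s => f₁ s * conj (f₂ s)) (f₁' * conj (f₂ s) + f₁ s * conj f₂') s :=
  h₁.mul h₂.star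

lemma hasDerivAt_re {f : ℝ → ℂ} {f' : ℂ} {s : ℝ} (hf : HasDerivAt f f' s) :
    HasDerivAt (fun s => (f s).re) f'.re s :=
  Complex.reCLM.hasFDerivAt.comp_hasDerivAt s hf

lemma hasDerivAt_im {f : ℝ → ℂ} {f' : ℂ} {s : ℝ} (hf : HasDerivAt f f' s) :
    HasDerivAt (fun s => (f s).im) f'.im s :=
  Complex.imCLM.hasFDerivAt.comp_hasDerivAt s hf

end ConservationLaws

/-- **Conservation-law identities for the free Schrödinger flow.** For a Schwartz datum `E₀` on
`ℝ^d` (`d = k + 1 ≥ 2`) and `E(t) = e^{itΔ}E₀`, writing `x = (x₁, y) ∈ ℝ × ℝ^{d-1}`: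
(i) `∂ₜ ∫ |E|²/2 dy = ∂_{x₁} ∫ Im(E ⬝ conj ∂_{x₁}E) dy`, and
(ii) `∂ₜ ∫ Im(E ⬝ conj ∂_{x₁}E) dy = ∂_{x₁} ∫ (2|∂_{x₁}E|² − ∂²_{x₁}(|E|²/2)) dy`. -/
theorem schrodinger_div_curl_identities (k : ℕ) (hk : 1 ≤ k)
    (E₀ : SchwartzMap (ℝ × (Fin k → ℝ)) ℂ)
    (E : ℝ → (ℝ × (Fin k → ℝ)) → ℂ) (hE : E = schrodingerEvol (⇑E₀))
    (t x₁ : ℝ) :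
    (deriv (fun τ => ∫ y : Fin k → ℝ, ‖E τ (x₁, y)‖ ^ 2 / 2) t =
      deriv (fun a => ∫ y : Fin k → ℝ,
        (E t (a, y) * (starRingEnd ℂ) (deriv (fun b => E t (b, y)) a)).im) x₁) ∧
    (deriv (fun τ => ∫ y : Fin k → ℝ,
        (E τ (x₁, y) * (starRingEnd ℂ) (deriv (fun b => E τ (b, y)) x₁)).im) t =
      deriv (fun a => ∫ y : Fin k → ℝ,
        (2 * ‖deriv (fun b => E t (b, y)) a‖ ^ 2 -
          deriv (deriv (fun b => ‖E t (b, y)‖ ^ 2 / 2)) a)) x₁) := by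
  obtain ⟨g₀, hg₀⟩ := exists_schwartzMap_eq_FT E₀
  set g : 𝓢(ℝ × (Fin k → ℝ), ℂ) := (((2 * Real.pi) ^ (k + 1) : ℝ)⁻¹ : ℂ) • g₀ with hg
  obtain rfl : E = wavePacket g := by
    ext t x
    rw [hE, schrodingerEvol, hg, wavePacket_smul, ← hg₀, ← Complex.ofReal_inv]
    exact Complex.real_smul
  set D : 𝓢(ℝ × (Fin k → ℝ), ℂ) → 𝓢(ℝ × (Fin k → ℝ), ℂ) := derivMul 0 (1, 0)
  have hDeriv : ∀ (f : 𝓢(ℝ × (Fin k → ℝ), ℂ)) (t a : ℝ) (y : Fin k → ℝ),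
      HasDerivAt (fun b => wavePacket f t (b, y)) (wavePacket (D f) t (a, y)) a :=
    hasDerivAt_wavePacket_fst
  have hD : ∀ (f : 𝓢(ℝ × (Fin k → ℝ), ℂ)) (t a : ℝ) (y : Fin k → ℝ),
      deriv (fun b => wavePacket f t (b, y)) a = wavePacket (D f) t (a, y) :=
    fun f t a y => (hDeriv f t a y).deriv
  have hconj : ∀ f₁ f₂ : 𝓢(ℝ × (Fin k → ℝ), ℂ),
      (slicePairing f₁ f₂ t x₁).re = (slicePairing f₂ f₁ t x₁).re ∧
      (slicePairing f₁ f₂ t x₁).im = -(slicePairing f₂ f₁ t x₁).im := fun f₁ f₂ => by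
    simp [← conj_slicePairing f₂ f₁]
  simp only [hD, integral_im_eq_im_slicePairing]
  constructor
  · have hmass : ∀ τ, ∫ y : Fin k → ℝ, ‖wavePacket g τ (x₁, y)‖ ^ 2 / 2 =
        (slicePairing g g τ x₁).re / 2 := fun τ => by
      rw [integral_div, ← integral_re_eq_re_slicePairing]
      simp only [re_mul_conj_self]
    simp only [hmass]
    rw [((hasDerivAt_re (hasDerivAt_slicePairing_time g g t x₁)).div_const 2).deriv,
      (hasDerivAt_im (hasDerivAt_slicePairing_fst g (D g) t x₁)).deriv]
    have h1 := hconj (D g) (D g)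
    have h2 := hconj g (D (D g))
    simp only [Complex.add_im, Complex.mul_re, Complex.I_re, Complex.I_im, Complex.sub_im, D] at *
    linarith
  · have hsecond : ∀ a y, 2 * ‖wavePacket (D g) t (a, y)‖ ^ 2 -
        deriv (deriv fun b => ‖wavePacket g t (b, y)‖ ^ 2 / 2) a =
        (wavePacket (D g) t (a, y) * (starRingEnd ℂ) (wavePacket (D g) t (a, y))).re -
        (wavePacket g t (a, y) * (starRingEnd ℂ) (wavePacket (D (D g)) t (a, y))).re := by
      intro a y
      have h1 : (deriv fun b => ‖wavePacket g t (b, y)‖ ^ 2 / 2) = fun b =>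
          (wavePacket g t (b, y) * (starRingEnd ℂ) (wavePacket (D g) t (b, y))).re := by
        ext b
        have := ((hasDerivAt_re (hasDerivAt_mul_conj
          (hDeriv g t b y) (hDeriv g t b y))).div_const 2).deriv
        simp only [← re_mul_conj_self]
        refine this.trans ?_
        simp
        ring
      rw [h1, (hasDerivAt_re (hasDerivAt_mul_conj (hDeriv g t a y) (hDeriv (D g) t a y))).deriv,
        ← re_mul_conj_self]
      simp
      ring
    have hflux : ∀ a, ∫ y : Fin k → ℝ, (2 * ‖wavePacket (D g) t (a, y)‖ ^ 2 -
        deriv (deriv fun b => ‖wavePacket g t (b, y)‖ ^ 2 / 2) a) =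
        (slicePairing (D g) (D g) t a).re - (slicePairing g (D (D g)) t a).re := fun a => by
      simp only [hsecond]
      rw [← integral_re_eq_re_slicePairing, ← integral_re_eq_re_slicePairing]
      exact integral_sub (integrable_slice_mul_conj _ _ _ _).re
        (integrable_slice_mul_conj _ _ _ _).re
    simp only [hflux]
    rw [(hasDerivAt_im (hasDerivAt_slicePairing_time g (D g) t x₁)).deriv,
      ((hasDerivAt_re (hasDerivAt_slicePairing_fst (D g) (D g) t x₁)).fun_sub
        (hasDerivAt_re (hasDerivAt_slicePairing_fst g (D (D g)) t x₁))).deriv]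
    simp only [Complex.mul_im, Complex.I_re, Complex.I_im, Complex.sub_re, Complex.add_re, D]
    ring
end
end

section
/- For every dimension d ≥ 2 there exist constants C > 0 and μ₀ ≥ 1, depending only on d, with the following property. Let λ ≥ 1 and μ ≥ μ₀. Let n₀, n₁ be real-valued Schwartz functions on ℝ^d whose Fourier transforms are supported in the annulus A_λ = {ξ : 8λ/9 ≤ |ξ| ≤ 9λ/4}, and let n(t) be the free wave evolution of (n₀, n₁). Let E₀ be a Schwartz function on ℝ^d whose Fourier transform is supported in A_μ ∩ {ξ = (ξ₁, ξ') ∈ ℝ × ℝ^{d−1} : |ξ₁| ≥ 100|ξ'|}, and let E(t) = e^{itΔ}E₀. Then for every T > 0, ( ∫₀^T ∫_ℝ ( ∫_{ℝ^{d−1}} |n(t,x₁,y)|² dy ) ( ∫_{ℝ^{d−1}} |E(t,x₁,y)|² dy ) dx₁ dt )^{1/2} ≤ C μ^{−1/2} ‖E₀‖_{L²(ℝ^d)} ( ‖n₀‖_{L²(ℝ^d)} + λ^{−1} ‖n₁‖_{L²(ℝ^d)} ). -/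
open MeasureTheory

noncomputable section

/-- The free wave evolution of data `(n₀, n₁)`, i.e. the function whose spatial Fourier
transform is `cos(t|ξ|) n̂₀(ξ) + (sin(t|ξ|)/|ξ|) n̂₁(ξ)`. -/
def waveEvol {k : ℕ} (n₀ n₁ : (ℝ × (Fin k → ℝ)) → ℂ) (t : ℝ) (x : ℝ × (Fin k → ℝ)) : ℂ :=
  ((2 * Real.pi) ^ (k + 1) : ℝ)⁻¹ •
    ∫ ξ : ℝ × (Fin k → ℝ),
      Complex.exp (Complex.I * (dotp x ξ : ℂ)) *
        ((Real.cos (t * Real.sqrt (nsq ξ)) : ℂ) * FT n₀ ξ +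
         ((Real.sin (t * Real.sqrt (nsq ξ)) / Real.sqrt (nsq ξ) : ℝ) : ℂ) * FT n₁ ξ)

/-- The half-wave evolution `e^{-itΛ}v₀`, `Λ = (-Δ)^{1/2}`, i.e. the function whose spatial
Fourier transform is `e^{-it|ξ|} v̂₀(ξ)`. -/
def halfWaveEvol {k : ℕ} (v₀ : (ℝ × (Fin k → ℝ)) → ℂ) (t : ℝ) (x : ℝ × (Fin k → ℝ)) : ℂ :=
  ((2 * Real.pi) ^ (k + 1) : ℝ)⁻¹ •
    ∫ ξ : ℝ × (Fin k → ℝ),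
      Complex.exp (Complex.I * (dotp x ξ : ℂ) -
        Complex.I * (t : ℂ) * (Real.sqrt (nsq ξ) : ℂ)) * FT v₀ ξ

/-- Membership in the annulus `A_λ = {ξ : 8λ/9 ≤ |ξ| ≤ 9λ/4}`. -/
def inA {k : ℕ} (lam : ℝ) (ξ : ℝ × (Fin k → ℝ)) : Prop :=
  8 * lam / 9 ≤ Real.sqrt (nsq ξ) ∧ Real.sqrt (nsq ξ) ≤ 9 * lam / 4

/-- Membership in the cone `{ξ = (ξ₁, ξ') : |ξ₁| ≥ 100|ξ'|}`. -/
def inCone {k : ℕ} (ξ : ℝ × (Fin k → ℝ)) : Prop :=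
  100 * Real.sqrt (∑ i, ξ.2 i ^ 2) ≤ |ξ.1|

open Filter Topology
open scoped ENNReal

section Schur

variable {X Y : Type*} [MeasurableSpace X] [MeasurableSpace Y]
  {ρ : Measure X} {ν : Measure Y}

theorem ENNReal.mul_le_sq_add_sq (a b : ℝ≥0∞) : a * b ≤ a ^ 2 + b ^ 2 := by
  rcases le_total a b with h | h
  · calc a * b ≤ b * b := by gcongr
      _ ≤ _ := by rw [← sq]; exact le_add_self
  · calc a * b ≤ a * a := by gcongr
      _ ≤ _ := by rw [← sq]; exact le_self_add

theorem integrable_weight_mul_phase_pair {w : Y → ℝ} (hwi : Integrable w ν) {θ : Y → X → ℝ}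
    (hθ : Measurable (Function.uncurry θ)) {F : X → ℂ} (hF : Integrable F ρ) :
    Integrable (fun q : Y × (X × X) =>
      ((w q.1 : ℂ) * Complex.exp (Complex.I * ((θ q.1 q.2.1 - θ q.1 q.2.2 : ℝ) : ℂ))) *
        (F q.2.1 * (starRingEnd ℂ) (F q.2.2))) (ν.prod (ρ.prod ρ)) := by
  have h1 : Integrable (fun p : X × X => F p.1 * (starRingEnd ℂ) (F p.2)) (ρ.prod ρ) :=
    hF.mul_prod ((RCLike.conjLIE (K := ℂ)).toContinuousLinearEquiv.integrable_comp_iff.2 hF)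
  have h2 := (hwi.ofReal (𝕜 := ℂ)).mul_prod h1
  have hm : Measurable fun q : Y × (X × X) =>
      Complex.exp (Complex.I * ((θ q.1 q.2.1 - θ q.1 q.2.2 : ℝ) : ℂ)) := by
    have a1 : Measurable fun q : Y × (X × X) => θ q.1 q.2.1 :=
      hθ.comp (measurable_fst.prodMk (measurable_fst.comp measurable_snd))
    have a2 : Measurable fun q : Y × (X × X) => θ q.1 q.2.2 :=
      hθ.comp (measurable_fst.prodMk (measurable_snd.comp measurable_snd))
    fun_prop
  refine (h2.bdd_mul (c := 1) hm.aestronglyMeasurable (ae_of_all _ fun q => ?_)).congr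
    (ae_of_all _ fun q => ?_)
  · rw [mul_comm, Complex.norm_exp_ofReal_mul_I]
  · simp only [RCLike.ofReal_eq_complex_ofReal]; ring

variable [SFinite ρ] [SFinite ν]

/-- Schur's test for a weighted oscillatory integral operator, in `T T*` form. -/
theorem lintegral_weight_mul_oscillatory_le {w : Y → ℝ} (hw0 : ∀ y, 0 ≤ w y)
    (hwi : Integrable w ν) {θ : Y → X → ℝ} (hθ : Measurable (Function.uncurry θ)) {F : X → ℂ}
    (hF : Integrable F ρ) {K : X → X → ℝ≥0∞} (hK : Measurable (Function.uncurry K))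
    (hKs : ∀ x x', K x x' = K x' x)
    (hwK : ∀ x x', ‖∫ y, (w y : ℂ) * Complex.exp (Complex.I * ((θ y x - θ y x' : ℝ) : ℂ)) ∂ν‖ₑ
      ≤ K x x')
    {A : ℝ≥0∞} (hA : ∀ x, ∫⁻ x', K x x' ∂ρ ≤ A) :
    ∫⁻ y, ENNReal.ofReal (w y) * ‖∫ x, Complex.exp (Complex.I * (θ y x : ℂ)) * F x ∂ρ‖ₑ ^ 2 ∂ν
      ≤ 2 * A * ∫⁻ x, ‖F x‖ₑ ^ 2 ∂ρ := by
  have hbig := integrable_weight_mul_phase_pair hwi hθ hF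
  have hsq : ∀ y, ∫ p : X × X,
      ((w y : ℂ) * Complex.exp (Complex.I * ((θ y p.1 - θ y p.2 : ℝ) : ℂ))) *
        (F p.1 * (starRingEnd ℂ) (F p.2)) ∂(ρ.prod ρ) =
      ((w y * ‖∫ x, Complex.exp (Complex.I * (θ y x : ℂ)) * F x ∂ρ‖ ^ 2 : ℝ) : ℂ) := by
    intro y
    have := integral_prod_mul (μ := ρ) (ν := ρ)
      (fun x => Complex.exp (Complex.I * (θ y x : ℂ)) * F x)
      (fun x => (starRingEnd ℂ) (Complex.exp (Complex.I * (θ y x : ℂ)) * F x))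
    rw [integral_conj, Complex.mul_conj'] at this
    push_cast
    rw [← this, ← integral_const_mul]
    congr 1 with p
    rw [map_mul, ← Complex.exp_conj, map_mul, Complex.conj_I, Complex.conj_ofReal, mul_sub,
      sub_eq_add_neg, Complex.exp_add]
    ring_nf
  have hint : Integrable (fun y =>
      w y * ‖∫ x, Complex.exp (Complex.I * (θ y x : ℂ)) * F x ∂ρ‖ ^ 2) ν := by
    have := hbig.integral_prod_left
    simp only [hsq] at this
    exact this.re
  have hnn : ∀ y, 0 ≤ w y * ‖∫ x, Complex.exp (Complex.I * (θ y x : ℂ)) * F x ∂ρ‖ ^ 2 :=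
    fun y => mul_nonneg (hw0 y) (sq_nonneg _)
  have hFm : AEMeasurable (fun x => ‖F x‖ₑ ^ 2) ρ := (hF.aestronglyMeasurable.enorm).pow_const 2
  calc _ = ∫⁻ y, ENNReal.ofReal
          (w y * ‖∫ x, Complex.exp (Complex.I * (θ y x : ℂ)) * F x ∂ρ‖ ^ 2) ∂ν := by
        congr 1 with y
        rw [ENNReal.ofReal_mul (hw0 y), ENNReal.ofReal_pow (norm_nonneg _), ofReal_norm]
    _ = ‖∫ y, ∫ p : X × X,
          ((w y : ℂ) * Complex.exp (Complex.I * ((θ y p.1 - θ y p.2 : ℝ) : ℂ))) *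
            (F p.1 * (starRingEnd ℂ) (F p.2)) ∂(ρ.prod ρ) ∂ν‖ₑ := by
        rw [← ofReal_integral_eq_lintegral_ofReal hint (ae_of_all _ hnn)]
        simp only [hsq]
        rw [integral_complex_ofReal, ← ofReal_norm, Complex.norm_real, Real.norm_eq_abs,
          abs_of_nonneg (integral_nonneg hnn)]
    _ = ‖∫ p : X × X, (∫ y, (w y : ℂ) *
            Complex.exp (Complex.I * ((θ y p.1 - θ y p.2 : ℝ) : ℂ)) ∂ν) *
            (F p.1 * (starRingEnd ℂ) (F p.2)) ∂(ρ.prod ρ)‖ₑ := by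
        rw [integral_integral_swap hbig]
        simp only [integral_mul_const]
    _ ≤ ∫⁻ p : X × X, K p.1 p.2 * (‖F p.1‖ₑ ^ 2 + ‖F p.2‖ₑ ^ 2) ∂(ρ.prod ρ) := by
        refine (enorm_integral_le_lintegral_enorm _).trans (lintegral_mono fun p => ?_)
        rw [enorm_mul, enorm_mul, RCLike.enorm_conj]
        exact mul_le_mul' (hwK _ _) (ENNReal.mul_le_sq_add_sq _ _)
    _ = ∫⁻ p : X × X, K p.1 p.2 * ‖F p.1‖ₑ ^ 2 ∂(ρ.prod ρ) +
          ∫⁻ p : X × X, K p.1 p.2 * ‖F p.2‖ₑ ^ 2 ∂(ρ.prod ρ) := by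
        simp only [mul_add]
        exact lintegral_add_left' (hK.aemeasurable.mul hFm.comp_fst) _
    _ ≤ A * ∫⁻ x, ‖F x‖ₑ ^ 2 ∂ρ + A * ∫⁻ x, ‖F x‖ₑ ^ 2 ∂ρ := by
        rw [lintegral_prod (fun p : X × X => K p.1 p.2 * ‖F p.1‖ₑ ^ 2)
            (hK.aemeasurable.mul hFm.comp_fst),
          lintegral_prod_symm (fun p : X × X => K p.1 p.2 * ‖F p.2‖ₑ ^ 2)
            (hK.aemeasurable.mul hFm.comp_snd),
          ← lintegral_const_mul'' _ hFm]
        refine add_le_add (lintegral_mono fun x => ?_) (lintegral_mono fun x => ?_)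
        · dsimp only
          rw [lintegral_mul_const' _ _ (by simp)]
          gcongr
          exact hA x
        · dsimp only
          rw [lintegral_mul_const' _ _ (by simp)]
          gcongr
          simpa only [hKs] using hA x
    _ = _ := by ring

/-- `L²` bound for an oscillatory integral operator, from Schur's test uniformly along a sequence
of weights converging to `1`. -/
theorem lintegral_oscillatory_le {w : ℕ → Y → ℝ} (hw0 : ∀ n y, 0 ≤ w n y)
    (hwi : ∀ n, Integrable (w n) ν) (hw1 : ∀ y, Tendsto (fun n => w n y) atTop (𝓝 1))
    {θ : Y → X → ℝ} (hθ : Measurable (Function.uncurry θ)) {F : X → ℂ}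
    (hF : Integrable F ρ) {K : ℕ → X → X → ℝ≥0∞} (hK : ∀ n, Measurable (Function.uncurry (K n)))
    (hKs : ∀ n x x', K n x x' = K n x' x)
    (hwK : ∀ n x x',
      ‖∫ y, (w n y : ℂ) * Complex.exp (Complex.I * ((θ y x - θ y x' : ℝ) : ℂ)) ∂ν‖ₑ ≤ K n x x')
    {A : ℝ≥0∞} (hA : ∀ n x, ∫⁻ x', K n x x' ∂ρ ≤ A) :
    ∫⁻ y, ‖∫ x, Complex.exp (Complex.I * (θ y x : ℂ)) * F x ∂ρ‖ₑ ^ 2 ∂ν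
      ≤ 2 * A * ∫⁻ x, ‖F x‖ₑ ^ 2 ∂ρ := by
  have hm : AEMeasurable
      (fun y => ‖∫ x, Complex.exp (Complex.I * (θ y x : ℂ)) * F x ∂ρ‖ₑ ^ 2) ν := by
    have : AEStronglyMeasurable
        (fun q : Y × X => Complex.exp (Complex.I * (θ q.1 q.2 : ℂ)) * F q.2) (ν.prod ρ) := by
      refine AEStronglyMeasurable.mul (Measurable.aestronglyMeasurable ?_)
        hF.aestronglyMeasurable.comp_snd
      have : Measurable fun q : Y × X => θ q.1 q.2 := hθ
      fun_prop
    exact this.integral_prod_right'.enorm.pow_const 2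
  have hlim : ∀ y, liminf (fun n => ENNReal.ofReal (w n y) *
      ‖∫ x, Complex.exp (Complex.I * (θ y x : ℂ)) * F x ∂ρ‖ₑ ^ 2) atTop =
      ‖∫ x, Complex.exp (Complex.I * (θ y x : ℂ)) * F x ∂ρ‖ₑ ^ 2 := by
    intro y
    refine Tendsto.liminf_eq ?_
    have := ENNReal.Tendsto.mul_const (ENNReal.tendsto_ofReal (hw1 y))
      (b := ‖∫ x, Complex.exp (Complex.I * (θ y x : ℂ)) * F x ∂ρ‖ₑ ^ 2) (Or.inl (by simp))
    simpa using this
  calc _ = ∫⁻ y, liminf (fun n => ENNReal.ofReal (w n y) *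
            ‖∫ x, Complex.exp (Complex.I * (θ y x : ℂ)) * F x ∂ρ‖ₑ ^ 2) atTop ∂ν := by
        simp only [hlim]
    _ ≤ liminf (fun n => ∫⁻ y, ENNReal.ofReal (w n y) *
            ‖∫ x, Complex.exp (Complex.I * (θ y x : ℂ)) * F x ∂ρ‖ₑ ^ 2 ∂ν) atTop :=
        lintegral_liminf_le' fun n =>
          ((hwi n).aestronglyMeasurable.aemeasurable.ennreal_ofReal).mul hm
    _ ≤ _ := by
        refine liminf_le_of_frequently_le' (Frequently.of_forall fun n => ?_)
        exact lintegral_weight_mul_oscillatory_le (hw0 n) (hwi n) hθ hF (hK n) (hKs n) (hwK n)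
          (hA n)

end Schur

/-- The Gaussian weight `e^{-b s²}`. -/
def gaussWeight (b s : ℝ) : ℝ := Real.exp (-b * s ^ 2)

/-- The Fourier transform of `gaussWeight b`. -/
def gaussKernel (b s : ℝ) : ℝ := Real.sqrt (Real.pi / b) * Real.exp (-(4 * b)⁻¹ * s ^ 2)

section Gauss

variable {b : ℝ}

theorem gaussWeight_nonneg (b s : ℝ) : 0 ≤ gaussWeight b s := (Real.exp_pos _).le

theorem gaussKernel_nonneg (b s : ℝ) : 0 ≤ gaussKernel b s := by unfold gaussKernel; positivity

theorem gaussKernel_neg (b s : ℝ) : gaussKernel b (-s) = gaussKernel b s := by simp [gaussKernel]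

@[fun_prop]
theorem measurable_gaussKernel (b : ℝ) : Measurable (gaussKernel b) := by
  unfold gaussKernel; fun_prop

theorem gaussKernel_le_of_abs_le (hb : 0 < b) {s r : ℝ} (h : |s| ≤ |r|) :
    gaussKernel b r ≤ gaussKernel b s := by
  unfold gaussKernel
  have := sq_le_sq.2 h
  have h4 : 0 < (4 * b)⁻¹ := by positivity
  have := mul_le_mul_of_nonneg_left this h4.le
  gcongr ?_ * Real.exp ?_
  linarith

theorem integrable_gaussWeight (hb : 0 < b) : Integrable (gaussWeight b) :=
  integrable_exp_neg_mul_sq hb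

theorem integral_gaussWeight_mul_exp (hb : 0 < b) (c : ℝ) :
    ∫ s : ℝ, (gaussWeight b s : ℂ) * Complex.exp (Complex.I * ((s * c : ℝ) : ℂ)) =
      (gaussKernel b c : ℂ) := by
  have h := fourierIntegral_gaussian (b := (b : ℂ)) (by simpa using hb) (c : ℂ)
  have e1 : (((Real.pi : ℂ) / b) ^ (1 / 2 : ℂ)) = ((Real.sqrt (Real.pi / b) : ℝ) : ℂ) := by
    rw [Real.sqrt_eq_rpow, Complex.ofReal_cpow (by positivity)]
    push_cast; rfl
  rw [e1] at h
  unfold gaussWeight gaussKernel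
  push_cast
  convert h using 1
  · congr 1 with s
    rw [mul_comm]
    congr 2
    ring
  · congr 2
    field_simp

theorem lintegral_gaussKernel (hb : 0 < b) :
    ∫⁻ s : ℝ, ENNReal.ofReal (gaussKernel b s) = ENNReal.ofReal (2 * Real.pi) := by
  have h4 : 0 < (4 * b)⁻¹ := by positivity
  have hi : Integrable (gaussKernel b) := (integrable_exp_neg_mul_sq h4).const_mul _
  rw [← ofReal_integral_eq_lintegral_ofReal hi (ae_of_all _ (gaussKernel_nonneg b))]
  unfold gaussKernel
  rw [integral_const_mul, integral_gaussian, ← Real.sqrt_mul (by positivity)]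
  congr 1
  rw [Real.sqrt_eq_iff_mul_self_eq (by positivity) (by positivity)]
  field_simp
  ring

theorem lintegral_gaussKernel_mul_sub (hb : 0 < b) {m : ℝ} (hm : 0 < m) (a : ℝ) :
    ∫⁻ s : ℝ, ENNReal.ofReal (gaussKernel b (m * (s - a))) =
      ENNReal.ofReal (2 * Real.pi / m) := by
  rw [lintegral_sub_right_eq_self (fun s => ENNReal.ofReal (gaussKernel b (m * s))) a]
  have h := lintegral_map_equiv (μ := (volume : Measure ℝ))
    (fun s => ENNReal.ofReal (gaussKernel b s))
    (Homeomorph.mulLeft₀ m hm.ne').toMeasurableEquiv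
  have h2 : Measure.map (Homeomorph.mulLeft₀ m hm.ne').toMeasurableEquiv volume =
      ENNReal.ofReal |m⁻¹| • (volume : Measure ℝ) := Real.map_volume_mul_left hm.ne'
  rw [h2, lintegral_smul_measure, lintegral_gaussKernel hb] at h
  refine h.symm.trans ?_
  rw [smul_eq_mul, ← ENNReal.ofReal_mul (abs_nonneg _), abs_of_pos (by positivity)]
  congr 1
  field_simp

theorem tendsto_gaussWeight (s : ℝ) :
    Tendsto (fun n : ℕ => gaussWeight (1 / ((n : ℝ) + 1)) s) atTop (𝓝 1) := by
  unfold gaussWeight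
  have h := (((tendsto_one_div_add_atTop_nhds_zero_nat (𝕜 := ℝ)).neg).mul_const (s ^ 2)).rexp
  simpa using h

variable {ι : Type*} [Fintype ι]

theorem integrable_prod_gaussWeight (hb : 0 < b) :
    Integrable (fun y : ι → ℝ => ∏ i, gaussWeight b (y i)) :=
  Integrable.fintype_prod (f := fun _ : ι => gaussWeight b) fun _ => integrable_gaussWeight hb

theorem integral_prod_gaussWeight_mul_exp (hb : 0 < b) (c : ι → ℝ) :
    ∫ y : ι → ℝ, ((∏ i, gaussWeight b (y i) : ℝ) : ℂ) *
        Complex.exp (Complex.I * ((∑ i, y i * c i : ℝ) : ℂ)) =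
      ((∏ i, gaussKernel b (c i) : ℝ) : ℂ) := by
  push_cast
  simp only [← integral_gaussWeight_mul_exp hb]
  rw [← integral_fintype_prod_volume_eq_prod (𝕜 := ℂ) (E := fun _ : ι => ℝ)
    (fun i s => (gaussWeight b s : ℂ) * Complex.exp (Complex.I * ((s * c i : ℝ) : ℂ)))]
  congr 1 with y
  rw [Finset.prod_mul_distrib, Finset.mul_sum, Complex.exp_sum]
  push_cast
  rfl

theorem lintegral_prod_gaussKernel_sub (hb : 0 < b) (a : ι → ℝ) :
    ∫⁻ s : ι → ℝ, ENNReal.ofReal (∏ i, gaussKernel b (a i - s i)) =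
      ENNReal.ofReal ((2 * Real.pi) ^ Fintype.card ι) := by
  have h4 : 0 < (4 * b)⁻¹ := by positivity
  have hi : Integrable (gaussKernel b) := (integrable_exp_neg_mul_sq h4).const_mul _
  have h1 : ∫ s, gaussKernel b s = 2 * Real.pi := by
    have := lintegral_gaussKernel hb
    rw [← ofReal_integral_eq_lintegral_ofReal hi (ae_of_all _ (gaussKernel_nonneg b))] at this
    exact (ENNReal.ofReal_eq_ofReal_iff (integral_nonneg (gaussKernel_nonneg b))
      (by positivity)).1 this
  have hi' : Integrable (fun s : ι → ℝ => ∏ i, gaussKernel b (a i - s i)) :=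
    Integrable.fintype_prod (f := fun i s => gaussKernel b (a i - s))
      fun i => hi.comp_sub_left (a i)
  rw [← ofReal_integral_eq_lintegral_ofReal hi'
    (ae_of_all _ fun s => Finset.prod_nonneg fun i _ => gaussKernel_nonneg b _),
    integral_fintype_prod_volume_eq_prod (𝕜 := ℝ) (E := fun _ : ι => ℝ)
      (fun i s => gaussKernel b (a i - s))]
  congr 1
  simp only [integral_sub_left_eq_self (fun s => gaussKernel b s), h1]
  simp

end Gauss

section Dispersion

theorem abs_sqrt_sq_add_sub_le {q : ℝ} (hq : 0 ≤ q) (u v : ℝ) :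
    |Real.sqrt (u ^ 2 + q) - Real.sqrt (v ^ 2 + q)| ≤ |u - v| := by
  have key : ∀ u v : ℝ, Real.sqrt (u ^ 2 + q) ≤ Real.sqrt (v ^ 2 + q) + |u - v| := by
    intro u v
    have h1 : |v| ≤ Real.sqrt (v ^ 2 + q) := Real.abs_le_sqrt (by linarith)
    have h2 : Real.sqrt (v ^ 2 + q) ^ 2 = v ^ 2 + q := Real.sq_sqrt (by positivity)
    have h3 : v * (u - v) ≤ Real.sqrt (v ^ 2 + q) * |u - v| :=
      (le_abs_self _).trans (by rw [abs_mul]; gcongr)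
    refine Real.sqrt_le_iff.2 ⟨by positivity, ?_⟩
    nlinarith [sq_abs (u - v)]
  rw [abs_sub_le_iff]
  have := key u v
  have := key v u
  rw [abs_sub_comm] at this
  constructor <;> linarith

theorem mul_abs_sub_le_abs_phase_sub {mu σ q e a s r : ℝ} (hmu : 2 ≤ mu) (hσ : |σ| ≤ 1)
    (hq : 0 ≤ q) (h : (mu / 2 ≤ s ∧ mu / 2 ≤ r) ∨ (s ≤ -(mu / 2) ∧ r ≤ -(mu / 2))) :
    mu / 2 * |s - r| ≤
      |(-(s ^ 2 + e) + σ * Real.sqrt ((a - s) ^ 2 + q)) -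
        (-(r ^ 2 + e) + σ * Real.sqrt ((a - r) ^ 2 + q))| := by
  have h1 : mu * |s - r| ≤ |s ^ 2 - r ^ 2| := by
    have : s ^ 2 - r ^ 2 = (s + r) * (s - r) := by ring
    rw [this, abs_mul]
    gcongr
    rw [le_abs]
    rcases h with h | h
    · left; linarith
    · right; linarith
  have h2 : |σ * (Real.sqrt ((a - s) ^ 2 + q) - Real.sqrt ((a - r) ^ 2 + q))| ≤ |s - r| := by
    rw [abs_mul]
    have := abs_sqrt_sq_add_sub_le hq (a - s) (a - r)
    have e1 : |a - s - (a - r)| = |s - r| := by rw [← abs_neg]; congr 1; ring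
    rw [e1] at this
    nlinarith [abs_nonneg σ, abs_nonneg (s - r)]
  have h3 := abs_sub_abs_le_abs_sub (s ^ 2 - r ^ 2)
    (σ * (Real.sqrt ((a - s) ^ 2 + q) - Real.sqrt ((a - r) ^ 2 + q)))
  have e2 : (-(s ^ 2 + e) + σ * Real.sqrt ((a - s) ^ 2 + q)) -
      (-(r ^ 2 + e) + σ * Real.sqrt ((a - r) ^ 2 + q)) = -(s ^ 2 - r ^ 2 -
        σ * (Real.sqrt ((a - s) ^ 2 + q) - Real.sqrt ((a - r) ^ 2 + q))) := by ring
  rw [e2, abs_neg]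
  refine le_trans ?_ h3
  nlinarith [abs_nonneg (s - r)]

theorem setLIntegral_gaussKernel_comp_le {b m α β : ℝ} (hb : 0 < b) (hm : 0 < m) {H : ℝ → ℝ}
    (hH : Continuous H)
    (hexp : ∀ s ∈ Set.Icc α β, ∀ r ∈ Set.Icc α β, m * |s - r| ≤ |H s - H r|) (c : ℝ) :
    ∫⁻ s in Set.Icc α β, ENNReal.ofReal (gaussKernel b (c - H s)) ≤
      ENNReal.ofReal (4 * Real.pi / m) := by
  rcases (Set.Icc α β).eq_empty_or_nonempty with he | hne
  · simp [he]
  obtain ⟨r, hr, hmin⟩ := isCompact_Icc.exists_isMinOn hne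
    (f := fun s => |c - H s|) (by fun_prop)
  calc ∫⁻ s in Set.Icc α β, ENNReal.ofReal (gaussKernel b (c - H s))
      ≤ ∫⁻ s in Set.Icc α β, ENNReal.ofReal (gaussKernel b (m / 2 * (s - r))) := by
        refine setLIntegral_mono' measurableSet_Icc fun s hs => ?_
        refine ENNReal.ofReal_le_ofReal (gaussKernel_le_of_abs_le hb ?_)
        have h1 : |c - H r| ≤ |c - H s| := hmin hs
        have h2 := hexp s hs r hr
        have h3 : |H s - H r| ≤ |c - H r| + |c - H s| := by
          have := abs_sub (c - H r) (c - H s)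
          rwa [show c - H r - (c - H s) = H s - H r by ring] at this
        rw [abs_mul, abs_of_pos (by positivity : 0 < m / 2)]
        linarith
    _ ≤ ∫⁻ s, ENNReal.ofReal (gaussKernel b (m / 2 * (s - r))) := setLIntegral_le_lintegral _ _
    _ = _ := by
        rw [lintegral_gaussKernel_mul_sub hb (by positivity)]
        congr 1
        field_simp
        ring

/-- The range of the first frequency variable on the Schrödinger support. -/
def freqRange (mu : ℝ) : Set ℝ :=
  Set.Icc (mu / 2) (9 * mu / 4) ∪ Set.Icc (-(9 * mu / 4)) (-(mu / 2))

theorem setLIntegral_gaussKernel_phase_le {b mu σ q : ℝ} (hb : 0 < b) (hmu : 2 ≤ mu)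
    (hσ : |σ| ≤ 1) (hq : 0 ≤ q) (e a c : ℝ) :
    ∫⁻ s in freqRange mu, ENNReal.ofReal (gaussKernel b
        (c - (-(s ^ 2 + e) + σ * Real.sqrt ((a - s) ^ 2 + q)))) ≤
      ENNReal.ofReal (16 * Real.pi / mu) := by
  have hpi := Real.pi_pos
  have hH : Continuous fun s : ℝ => -(s ^ 2 + e) + σ * Real.sqrt ((a - s) ^ 2 + q) := by fun_prop
  refine (lintegral_union_le _ _ _).trans ?_
  have e1 : ENNReal.ofReal (16 * Real.pi / mu) =
      ENNReal.ofReal (4 * Real.pi / (mu / 2)) + ENNReal.ofReal (4 * Real.pi / (mu / 2)) := by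
    rw [← ENNReal.ofReal_add (by positivity) (by positivity)]
    congr 1
    field_simp
    ring
  rw [e1]
  refine add_le_add (setLIntegral_gaussKernel_comp_le hb (by positivity) hH ?_ c)
    (setLIntegral_gaussKernel_comp_le hb (by positivity) hH ?_ c)
  · exact fun s hs r hr => mul_abs_sub_le_abs_phase_sub hmu hσ hq (Or.inl ⟨hs.1, hr.1⟩)
  · exact fun s hs r hr => mul_abs_sub_le_abs_phase_sub hmu hσ hq (Or.inr ⟨hs.2, hr.2⟩)

end Dispersion

section Bilinear

variable {k : ℕ}

@[fun_prop]
theorem measurable_nsq : Measurable (nsq (k := k)) := by unfold nsq; fun_prop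

theorem lintegral_pair_eq {m : Measure ℝ} [SFinite m]
    {f : (ℝ × (Fin k → ℝ)) × (ℝ × (Fin k → ℝ)) → ℝ≥0∞} (hf : Measurable f) :
    ∫⁻ p, f p ∂((m.prod volume).prod volume) =
      ∫⁻ ξ' : Fin k → ℝ, ∫⁻ η' : Fin k → ℝ, ∫⁻ a : ℝ, ∫⁻ s : ℝ, f ((s, ξ'), (a - s, η')) ∂m := by
  rw [lintegral_prod _ hf.aemeasurable, lintegral_prod_symm _ hf.lintegral_prod_right'.aemeasurable]
  refine lintegral_congr fun ξ' => ?_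
  calc _ = ∫⁻ s, (∫⁻ η' : Fin k → ℝ, ∫⁻ a : ℝ, f ((s, ξ'), (a - s, η'))) ∂m := by
        refine lintegral_congr fun s => ?_
        rw [Measure.volume_eq_prod, lintegral_prod_symm _ (by fun_prop)]
        refine lintegral_congr fun η' => ?_
        exact (lintegral_sub_right_eq_self (fun a => f ((s, ξ'), (a, η'))) s).symm
    _ = ∫⁻ η' : Fin k → ℝ, ∫⁻ s, (∫⁻ a : ℝ, f ((s, ξ'), (a - s, η'))) ∂m := by
        refine lintegral_lintegral_swap (Measurable.aemeasurable ?_)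
        exact Measurable.lintegral_prod_right' (f := fun q : (ℝ × (Fin k → ℝ)) × ℝ =>
          f ((q.1.1, ξ'), (q.2 - q.1.1, q.1.2))) (by fun_prop)
    _ = _ := by
        refine lintegral_congr fun η' => ?_
        refine lintegral_lintegral_swap (f := fun s a => f ((s, ξ'), (a - s, η')))
          (Measurable.aemeasurable ?_)
        unfold Function.uncurry
        fun_prop

/-- The dual variable to time for a pair of a Schrödinger and a half-wave frequency. -/
def timePhase (σ : ℝ) (p : (ℝ × (Fin k → ℝ)) × (ℝ × (Fin k → ℝ))) : ℝ :=
  -nsq p.1 + σ * Real.sqrt (nsq p.2)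

@[fun_prop]
theorem measurable_timePhase (σ : ℝ) : Measurable (timePhase (k := k) σ) := by
  unfold timePhase; fun_prop

/-- The phase of the product of a Schrödinger and a half-wave evolution at time `t`, first
coordinate `x` and transversal coordinates `z` and `y` respectively. -/
def pairPhase (σ : ℝ) (q : ℝ × (ℝ × ((Fin k → ℝ) × (Fin k → ℝ))))
    (p : (ℝ × (Fin k → ℝ)) × (ℝ × (Fin k → ℝ))) : ℝ :=
  q.1 * timePhase σ p + (q.2.1 * (p.1.1 + p.2.1) +
    (∑ i, q.2.2.1 i * p.2.2 i + ∑ i, q.2.2.2 i * p.1.2 i))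

/-- The kernel obtained by integrating `pairPhase` against Gaussian weights. -/
def pairKernel (σ b : ℝ) (p p' : (ℝ × (Fin k → ℝ)) × (ℝ × (Fin k → ℝ))) : ℝ≥0∞ :=
  ENNReal.ofReal (∏ i, gaussKernel b (p.1.2 i - p'.1.2 i)) *
    (ENNReal.ofReal (∏ i, gaussKernel b (p.2.2 i - p'.2.2 i)) *
      (ENNReal.ofReal (gaussKernel b ((p.1.1 + p.2.1) - (p'.1.1 + p'.2.1))) *
        ENNReal.ofReal (gaussKernel b (timePhase σ p - timePhase σ p'))))

/-- The product Gaussian weight in time, first coordinate and two transversal coordinates. -/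
def pairWeight (b : ℝ) (q : ℝ × (ℝ × ((Fin k → ℝ) × (Fin k → ℝ)))) : ℝ :=
  gaussWeight b q.1 * (gaussWeight b q.2.1 *
    ((∏ i, gaussWeight b (q.2.2.1 i)) * ∏ i, gaussWeight b (q.2.2.2 i)))

theorem lintegral_pairKernel_le {b mu σ : ℝ} (hb : 0 < b) (hmu : 2 ≤ mu) (hσ : |σ| ≤ 1)
    (p : (ℝ × (Fin k → ℝ)) × (ℝ × (Fin k → ℝ))) :
    ∫⁻ p', pairKernel σ b p p' ∂(((volume.restrict (freqRange mu)).prod volume).prod volume) ≤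
      ENNReal.ofReal ((2 * Real.pi) ^ k) * (ENNReal.ofReal ((2 * Real.pi) ^ k) *
        (ENNReal.ofReal (2 * Real.pi) * ENNReal.ofReal (16 * Real.pi / mu))) := by
  have hmeas : Measurable (pairKernel σ b p) := by unfold pairKernel; fun_prop
  rw [lintegral_pair_eq hmeas]
  have hk := lintegral_prod_gaussKernel_sub (ι := Fin k) hb
  rw [Fintype.card_fin] at hk
  calc _ ≤ ∫⁻ ξ' : Fin k → ℝ, ∫⁻ η' : Fin k → ℝ, ∫⁻ a : ℝ,
          ENNReal.ofReal (∏ i, gaussKernel b (p.1.2 i - ξ' i)) *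
            (ENNReal.ofReal (∏ i, gaussKernel b (p.2.2 i - η' i)) *
              (ENNReal.ofReal (gaussKernel b ((p.1.1 + p.2.1) - a)) *
                ENNReal.ofReal (16 * Real.pi / mu))) := by
        refine lintegral_mono fun ξ' => lintegral_mono fun η' => lintegral_mono fun a => ?_
        simp only [pairKernel, add_sub_cancel]
        rw [lintegral_const_mul' _ _ ENNReal.ofReal_ne_top,
          lintegral_const_mul' _ _ ENNReal.ofReal_ne_top,
          lintegral_const_mul' _ _ ENNReal.ofReal_ne_top]
        gcongr
        exact setLIntegral_gaussKernel_phase_le hb hmu hσ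
          (Finset.sum_nonneg fun i _ => sq_nonneg (η' i)) (∑ i, ξ' i ^ 2) a (timePhase σ p)
    _ = _ := by
        have h1 : ∫⁻ a : ℝ, ENNReal.ofReal (gaussKernel b ((p.1.1 + p.2.1) - a)) =
            ENNReal.ofReal (2 * Real.pi) := by
          rw [lintegral_sub_left_eq_self (fun a => ENNReal.ofReal (gaussKernel b a)),
            lintegral_gaussKernel hb]
        simp only [lintegral_const_mul' _ _ ENNReal.ofReal_ne_top,
          lintegral_mul_const' _ _ ENNReal.ofReal_ne_top, h1]
        rw [lintegral_congr fun ξ' => congrArg _ (lintegral_mul_const' _ _ (by finiteness)), hk,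
          lintegral_mul_const' _ _ (by finiteness), hk]

theorem integral_prod_four_mul (f g : ℝ → ℂ) (h l : (Fin k → ℝ) → ℂ) :
    ∫ q : ℝ × (ℝ × ((Fin k → ℝ) × (Fin k → ℝ))),
        f q.1 * (g q.2.1 * (h q.2.2.1 * l q.2.2.2)) =
      (∫ t, f t) * ((∫ x, g x) * ((∫ y, h y) * ∫ z, l z)) := by
  rw [← integral_prod_mul h l, ← integral_prod_mul g fun r : (Fin k → ℝ) × (Fin k → ℝ) =>
    h r.1 * l r.2, ← integral_prod_mul f fun r : ℝ × ((Fin k → ℝ) × (Fin k → ℝ)) =>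
    g r.1 * (h r.2.1 * l r.2.2)]
  rfl

theorem enorm_integral_pairWeight_mul_exp {b σ : ℝ} (hb : 0 < b)
    (p p' : (ℝ × (Fin k → ℝ)) × (ℝ × (Fin k → ℝ))) :
    ‖∫ q, (pairWeight b q : ℂ) *
      Complex.exp (Complex.I * ((pairPhase σ q p - pairPhase σ q p' : ℝ) : ℂ))‖ₑ =
      pairKernel σ b p p' := by
  have e1 : ∀ q : ℝ × (ℝ × ((Fin k → ℝ) × (Fin k → ℝ))), (pairWeight b q : ℂ) *
      Complex.exp (Complex.I * ((pairPhase σ q p - pairPhase σ q p' : ℝ) : ℂ)) =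
      ((gaussWeight b q.1 : ℂ) * Complex.exp (Complex.I *
          ((q.1 * (timePhase σ p - timePhase σ p') : ℝ) : ℂ))) *
      (((gaussWeight b q.2.1 : ℂ) * Complex.exp (Complex.I *
          ((q.2.1 * ((p.1.1 + p.2.1) - (p'.1.1 + p'.2.1)) : ℝ) : ℂ))) *
      ((((∏ i, gaussWeight b (q.2.2.1 i) : ℝ) : ℂ) * Complex.exp (Complex.I *
          ((∑ i, q.2.2.1 i * (p.2.2 i - p'.2.2 i) : ℝ) : ℂ))) *
      (((∏ i, gaussWeight b (q.2.2.2 i) : ℝ) : ℂ) * Complex.exp (Complex.I *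
          ((∑ i, q.2.2.2 i * (p.1.2 i - p'.1.2 i) : ℝ) : ℂ))))) := by
    intro q
    have : pairPhase σ q p - pairPhase σ q p' =
        q.1 * (timePhase σ p - timePhase σ p') +
        (q.2.1 * ((p.1.1 + p.2.1) - (p'.1.1 + p'.2.1)) +
        (∑ i, q.2.2.1 i * (p.2.2 i - p'.2.2 i) + ∑ i, q.2.2.2 i * (p.1.2 i - p'.1.2 i))) := by
      simp only [pairPhase, mul_sub, Finset.sum_sub_distrib]
      ring
    rw [this]
    simp only [Complex.ofReal_add, mul_add, Complex.exp_add, pairWeight, Complex.ofReal_mul]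
    ring
  simp only [e1]
  rw [integral_prod_four_mul
      (fun t : ℝ => (gaussWeight b t : ℂ) * Complex.exp (Complex.I *
        ((t * (timePhase σ p - timePhase σ p') : ℝ) : ℂ)))
      (fun t : ℝ => (gaussWeight b t : ℂ) * Complex.exp (Complex.I *
        ((t * ((p.1.1 + p.2.1) - (p'.1.1 + p'.2.1)) : ℝ) : ℂ)))
      (fun y : Fin k → ℝ => ((∏ i, gaussWeight b (y i) : ℝ) : ℂ) * Complex.exp (Complex.I *
          ((∑ i, y i * (p.2.2 i - p'.2.2 i) : ℝ) : ℂ)))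
      (fun y : Fin k → ℝ => ((∏ i, gaussWeight b (y i) : ℝ) : ℂ) * Complex.exp (Complex.I *
          ((∑ i, y i * (p.1.2 i - p'.1.2 i) : ℝ) : ℂ))),
    integral_gaussWeight_mul_exp hb, integral_gaussWeight_mul_exp hb,
    integral_prod_gaussWeight_mul_exp hb, integral_prod_gaussWeight_mul_exp hb]
  have e2 : ∀ r : ℝ, 0 ≤ r → ‖(r : ℂ)‖ₑ = ENNReal.ofReal r := fun r hr => by
    rw [← ofReal_norm, Complex.norm_real, Real.norm_of_nonneg hr]
  have hprod : ∀ c : Fin k → ℝ, 0 ≤ ∏ i, gaussKernel b (c i) :=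
    fun c => Finset.prod_nonneg fun i _ => gaussKernel_nonneg b _
  rw [enorm_mul, enorm_mul, enorm_mul, e2 _ (gaussKernel_nonneg b _),
    e2 _ (gaussKernel_nonneg b _), e2 _ (hprod _), e2 _ (hprod _), pairKernel]
  ring

/-- Bilinear `L²` estimate for a product of a Schrödinger and a half-wave evolution with
transversal group velocities, with joint frequency profile `F`. -/
theorem lintegral_pairPhase_le {mu σ : ℝ} (hmu : 2 ≤ mu) (hσ : |σ| ≤ 1)
    {F : (ℝ × (Fin k → ℝ)) × (ℝ × (Fin k → ℝ)) → ℂ}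
    (hF : Integrable F (((volume.restrict (freqRange mu)).prod volume).prod volume)) :
    ∫⁻ q, ‖∫ p, Complex.exp (Complex.I * (pairPhase σ q p : ℂ)) * F p
        ∂(((volume.restrict (freqRange mu)).prod volume).prod volume)‖ₑ ^ 2 ≤
      2 * (ENNReal.ofReal ((2 * Real.pi) ^ k) * (ENNReal.ofReal ((2 * Real.pi) ^ k) *
        (ENNReal.ofReal (2 * Real.pi) * ENNReal.ofReal (16 * Real.pi / mu)))) *
      ∫⁻ p, ‖F p‖ₑ ^ 2 ∂(((volume.restrict (freqRange mu)).prod volume).prod volume) := by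
  have hb : ∀ n : ℕ, (0 : ℝ) < 1 / ((n : ℝ) + 1) := fun n => by positivity
  refine lintegral_oscillatory_le (w := fun n => pairWeight (1 / ((n : ℝ) + 1)))
    (K := fun n => pairKernel σ (1 / ((n : ℝ) + 1))) ?_ ?_ ?_ ?_ hF ?_ ?_
    (fun n p p' => (enorm_integral_pairWeight_mul_exp (hb n) p p').le)
    (fun n p => lintegral_pairKernel_le (hb n) hmu hσ p)
  · intro n q
    unfold pairWeight
    have := gaussWeight_nonneg (1 / ((n : ℝ) + 1))
    have h2 : ∀ c : Fin k → ℝ, 0 ≤ ∏ i, gaussWeight (1 / ((n : ℝ) + 1)) (c i) :=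
      fun c => Finset.prod_nonneg fun i _ => this _
    exact mul_nonneg (this _) (mul_nonneg (this _) (mul_nonneg (h2 _) (h2 _)))
  · intro n
    have h1 := integrable_gaussWeight (hb n)
    have h2 := integrable_prod_gaussWeight (ι := Fin k) (hb n)
    exact h1.mul_prod (h1.mul_prod (h2.mul_prod h2))
  · intro q
    have h := fun c : Fin k → ℝ => tendsto_finsetProd Finset.univ
      fun i _ => tendsto_gaussWeight (c i)
    simp only [Finset.prod_const_one] at h
    simpa [pairWeight] using (tendsto_gaussWeight q.1).mul ((tendsto_gaussWeight q.2.1).mul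
      ((h q.2.2.1).mul (h q.2.2.2)))
  · unfold pairPhase Function.uncurry; fun_prop
  · intro n; unfold pairKernel Function.uncurry; fun_prop
  · intro n p p'
    have h : ∀ x y : ℝ, gaussKernel (1 / ((n : ℝ) + 1)) (x - y) =
        gaussKernel (1 / ((n : ℝ) + 1)) (y - x) := fun x y => by
      rw [← gaussKernel_neg, neg_sub]
    simp only [pairKernel]
    rw [h (p.1.1 + p.2.1), h (timePhase σ p)]
    simp only [fun i => h (p.1.2 i), fun i => h (p.2.2 i)]

end Bilinear

section Evolution

variable {k : ℕ}

@[fun_prop]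
theorem Measurable.dotp {α : Type*} [MeasurableSpace α] {x ξ : α → ℝ × (Fin k → ℝ)}
    (hx : Measurable x) (hξ : Measurable ξ) : Measurable fun a => dotp (x a) (ξ a) := by
  unfold _root_.dotp; fun_prop

/-- The evolution with Fourier profile `f` and dispersion relation `φ`. -/
def oscEvol (φ : ℝ × (Fin k → ℝ) → ℝ) (f : ℝ × (Fin k → ℝ) → ℂ) (t : ℝ)
    (x : ℝ × (Fin k → ℝ)) : ℂ :=
  ∫ ξ, Complex.exp (Complex.I * ((dotp x ξ + t * φ ξ : ℝ) : ℂ)) * f ξ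

/-- The transversal mass of `oscEvol φ f` at time `q.1` and first coordinate `q.2`. -/
def transMass (φ : ℝ × (Fin k → ℝ) → ℝ) (f : ℝ × (Fin k → ℝ) → ℂ) (q : ℝ × ℝ) : ℝ≥0∞ :=
  ∫⁻ y : Fin k → ℝ, ‖oscEvol φ f q.1 (q.2, y)‖ₑ ^ 2

variable {φ : ℝ × (Fin k → ℝ) → ℝ} {f : ℝ × (Fin k → ℝ) → ℂ}

theorem measurable_oscEvol (hφ : Measurable φ) (hf : Measurable f) :
    Measurable fun q : ℝ × (ℝ × (Fin k → ℝ)) => oscEvol φ f q.1 q.2 := by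
  have h : Measurable fun r : (ℝ × (ℝ × (Fin k → ℝ))) × (ℝ × (Fin k → ℝ)) =>
      Complex.exp (Complex.I * ((dotp r.1.2 r.2 + r.1.1 * φ r.2 : ℝ) : ℂ)) * f r.2 := by
    fun_prop
  exact h.stronglyMeasurable.integral_prod_right'.measurable

theorem measurable_transMass (hφ : Measurable φ) (hf : Measurable f) :
    Measurable (transMass φ f) := by
  have h : Measurable fun r : (ℝ × ℝ) × (Fin k → ℝ) => ‖oscEvol φ f r.1.1 (r.1.2, r.2)‖ₑ ^ 2 :=
    ((measurable_oscEvol hφ hf).comp (g := fun q : ℝ × (ℝ × (Fin k → ℝ)) => oscEvol φ f q.1 q.2)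
      (f := fun r : (ℝ × ℝ) × (Fin k → ℝ) => (r.1.1, (r.1.2, r.2)))
      (by fun_prop)).enorm.pow_const 2
  exact h.lintegral_prod_right'

theorem lintegral_lintegral_mul_lintegral {A B : ℝ × (ℝ × (Fin k → ℝ)) → ℝ≥0∞}
    (hA : Measurable A) (hB : Measurable B) :
    ∫⁻ q : ℝ × ℝ, (∫⁻ y, A (q.1, (q.2, y))) * ∫⁻ y, B (q.1, (q.2, y)) =
      ∫⁻ q : ℝ × (ℝ × ((Fin k → ℝ) × (Fin k → ℝ))),
        B (q.1, (q.2.1, q.2.2.2)) * A (q.1, (q.2.1, q.2.2.1)) := by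
  have m3 : Measurable fun q : ℝ × (ℝ × ((Fin k → ℝ) × (Fin k → ℝ))) =>
      B (q.1, (q.2.1, q.2.2.2)) * A (q.1, (q.2.1, q.2.2.1)) := by fun_prop
  have hA' : Measurable fun r : (ℝ × ℝ) × (Fin k → ℝ) => A (r.1.1, (r.1.2, r.2)) := by fun_prop
  have hB' : Measurable fun r : (ℝ × ℝ) × (Fin k → ℝ) => B (r.1.1, (r.1.2, r.2)) := by fun_prop
  have m4 : Measurable fun q : ℝ × ℝ =>
      (∫⁻ y, A (q.1, (q.2, y))) * ∫⁻ y, B (q.1, (q.2, y)) :=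
    hA'.lintegral_prod_right'.mul hB'.lintegral_prod_right'
  rw [Measure.volume_eq_prod, lintegral_prod _ m4.aemeasurable, Measure.volume_eq_prod ℝ (ℝ × _),
    lintegral_prod _ m3.aemeasurable]
  refine lintegral_congr fun t => ?_
  have m5 : Measurable fun q : ℝ × ((Fin k → ℝ) × (Fin k → ℝ)) =>
      B (t, (q.1, q.2.2)) * A (t, (q.1, q.2.1)) := by fun_prop
  rw [Measure.volume_eq_prod, lintegral_prod _ m5.aemeasurable]
  refine lintegral_congr fun x => ?_
  have n1 : Measurable fun y : Fin k → ℝ => A (t, (x, y)) := by fun_prop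
  have n2 : Measurable fun y : Fin k → ℝ => B (t, (x, y)) := by fun_prop
  rw [← lintegral_prod_mul n1.aemeasurable n2.aemeasurable, ← Measure.volume_eq_prod]
  exact lintegral_congr fun r => mul_comm _ _

theorem lintegral_transMass_mul_le {mu σ : ℝ} (hmu : 2 ≤ mu) (hσ : |σ| ≤ 1)
    {f g : ℝ × (Fin k → ℝ) → ℂ} (hf : Integrable f) (hg : Integrable g) (hfm : Measurable f)
    (hgm : Measurable g) (hfs : ∀ ξ, ξ.1 ∉ freqRange mu → f ξ = 0) :
    ∫⁻ q, transMass (fun ξ => σ * Real.sqrt (nsq ξ)) g q * transMass (fun ξ => -nsq ξ) f q ≤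
      ENNReal.ofReal (2 * ((2 * Real.pi) ^ k * ((2 * Real.pi) ^ k *
        (2 * Real.pi * (16 * Real.pi / mu))))) * ((∫⁻ ξ, ‖f ξ‖ₑ ^ 2) * ∫⁻ ξ, ‖g ξ‖ₑ ^ 2) := by
  have hmu0 : 0 < mu := by linarith
  have hpi := Real.pi_pos
  set ρ : Measure (ℝ × (Fin k → ℝ)) := (volume.restrict (freqRange mu)).prod volume with hρ
  have hρ' : ρ = volume.restrict (freqRange mu ×ˢ Set.univ) := by
    rw [hρ, Measure.volume_eq_prod, ← Measure.prod_restrict, Measure.restrict_univ]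
  have hfρ : Integrable f ρ := by rw [hρ']; exact hf.restrict
  have hφ₁ : Measurable fun ξ : ℝ × (Fin k → ℝ) => σ * Real.sqrt (nsq ξ) := by fun_prop
  have hφ₂ : Measurable fun ξ : ℝ × (Fin k → ℝ) => -nsq ξ := by fun_prop
  have hprod : ∀ q : ℝ × (ℝ × ((Fin k → ℝ) × (Fin k → ℝ))),
      ∫ p, Complex.exp (Complex.I * (pairPhase σ q p : ℂ)) * (f p.1 * g p.2) ∂(ρ.prod volume) =
      oscEvol (fun ξ => -nsq ξ) f q.1 (q.2.1, q.2.2.2) *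
        oscEvol (fun ξ => σ * Real.sqrt (nsq ξ)) g q.1 (q.2.1, q.2.2.1) := by
    intro q
    have e1 : oscEvol (fun ξ => -nsq ξ) f q.1 (q.2.1, q.2.2.2) =
        ∫ ξ, Complex.exp (Complex.I * ((dotp (q.2.1, q.2.2.2) ξ + q.1 * -nsq ξ : ℝ) : ℂ)) * f ξ
          ∂ρ := by
      rw [hρ', setIntegral_eq_integral_of_forall_compl_eq_zero]
      · rfl
      · intro ξ hξ
        rw [hfs ξ (fun h => hξ ⟨h, trivial⟩), mul_zero]
    rw [e1, oscEvol, ← integral_prod_mul]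
    congr 1 with p
    have : pairPhase σ q p = (dotp (q.2.1, q.2.2.2) p.1 + q.1 * -nsq p.1) +
        (dotp (q.2.1, q.2.2.1) p.2 + q.1 * (σ * Real.sqrt (nsq p.2))) := by
      simp only [pairPhase, timePhase, dotp]; ring
    rw [this, Complex.ofReal_add, mul_add, Complex.exp_add]
    ring
  have key := lintegral_pairPhase_le (k := k) hmu hσ (hfρ.mul_prod hg)
  have hr : ∫⁻ p, ‖f p.1 * g p.2‖ₑ ^ 2 ∂(ρ.prod volume) ≤
      (∫⁻ ξ, ‖f ξ‖ₑ ^ 2) * ∫⁻ ξ, ‖g ξ‖ₑ ^ 2 := by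
    simp only [enorm_mul, mul_pow]
    rw [lintegral_prod_mul (hfm.enorm.pow_const 2).aemeasurable
      (hgm.enorm.pow_const 2).aemeasurable]
    gcongr
    rw [hρ']
    exact Measure.restrict_le_self
  have hl : ∫⁻ q, transMass (fun ξ => σ * Real.sqrt (nsq ξ)) g q *
      transMass (fun ξ => -nsq ξ) f q = ∫⁻ q : ℝ × (ℝ × ((Fin k → ℝ) × (Fin k → ℝ))),
      ‖∫ p, Complex.exp (Complex.I * (pairPhase σ q p : ℂ)) * (f p.1 * g p.2)
        ∂(ρ.prod volume)‖ₑ ^ 2 := by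
    simp only [hprod, enorm_mul, mul_pow]
    have m1 := measurable_oscEvol hφ₁ hgm
    have m2 := measurable_oscEvol hφ₂ hfm
    exact lintegral_lintegral_mul_lintegral (m1.enorm.pow_const 2) (m2.enorm.pow_const 2)
  rw [hl]
  refine key.trans ?_
  have hc : ENNReal.ofReal (2 * ((2 * Real.pi) ^ k * ((2 * Real.pi) ^ k *
        (2 * Real.pi * (16 * Real.pi / mu))))) =
      2 * (ENNReal.ofReal ((2 * Real.pi) ^ k) * (ENNReal.ofReal ((2 * Real.pi) ^ k) *
        (ENNReal.ofReal (2 * Real.pi) * ENNReal.ofReal (16 * Real.pi / mu)))) := by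
    rw [ENNReal.ofReal_mul (by positivity), ENNReal.ofReal_mul (by positivity),
      ENNReal.ofReal_mul (by positivity), ENNReal.ofReal_mul (by positivity)]
    simp
  rw [hc]
  gcongr

theorem lintegral_FT_sq_le {u : ℝ × (Fin k → ℝ) → ℂ} (hu : Integrable u) :
    ∫⁻ ξ, ‖FT u ξ‖ₑ ^ 2 ≤
      ENNReal.ofReal (2 * (2 * Real.pi * (2 * Real.pi) ^ k)) * ∫⁻ x, ‖u x‖ₑ ^ 2 := by
  have hpi := Real.pi_pos
  have hb : ∀ n : ℕ, (0 : ℝ) < 1 / ((n : ℝ) + 1) := fun n => by positivity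
  have hFT : ∀ ξ, FT u ξ = ∫ x, Complex.exp (Complex.I * ((-dotp x ξ : ℝ) : ℂ)) * u x := by
    intro ξ
    simp only [FT]
    congr 1 with x
    push_cast
    ring_nf
  have hprod : ∀ b, ∀ c : Fin k → ℝ, 0 ≤ ∏ i, gaussKernel b (c i) :=
    fun b c => Finset.prod_nonneg fun i _ => gaussKernel_nonneg b _
  have hneg : ∀ (b : ℝ) (x y : ℝ), gaussKernel b (x - y) = gaussKernel b (y - x) :=
    fun b x y => by rw [← gaussKernel_neg, neg_sub]
  have hc : ENNReal.ofReal (2 * (2 * Real.pi * (2 * Real.pi) ^ k)) =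
      2 * (ENNReal.ofReal (2 * Real.pi) * ENNReal.ofReal ((2 * Real.pi) ^ k)) := by
    rw [ENNReal.ofReal_mul (by positivity), ENNReal.ofReal_mul (by positivity)]
    simp
  rw [hc]
  simp only [hFT]
  refine lintegral_oscillatory_le
    (w := fun n ξ => gaussWeight (1 / ((n : ℝ) + 1)) ξ.1 *
      ∏ i, gaussWeight (1 / ((n : ℝ) + 1)) (ξ.2 i))
    (K := fun n x x' => ENNReal.ofReal (gaussKernel (1 / ((n : ℝ) + 1)) (x.1 - x'.1)) *
      ENNReal.ofReal (∏ i, gaussKernel (1 / ((n : ℝ) + 1)) (x.2 i - x'.2 i)))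
    (θ := fun ξ x => -dotp x ξ) ?_ ?_ ?_ ?_ hu ?_ ?_ ?_ ?_
  · exact fun n ξ => mul_nonneg (gaussWeight_nonneg _ _)
      (Finset.prod_nonneg fun i _ => gaussWeight_nonneg _ _)
  · exact fun n => (integrable_gaussWeight (hb n)).mul_prod
      (integrable_prod_gaussWeight (ι := Fin k) (hb n))
  · intro ξ
    have h := tendsto_finsetProd Finset.univ fun i _ => tendsto_gaussWeight (ξ.2 i)
    simp only [Finset.prod_const_one] at h
    simpa using (tendsto_gaussWeight ξ.1).mul h
  · unfold Function.uncurry; fun_prop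
  · intro n; unfold Function.uncurry; fun_prop
  · intro n x x'
    rw [hneg _ x.1]
    simp only [fun i => hneg (1 / ((n : ℝ) + 1)) (x.2 i)]
  · intro n x x'
    have e1 : ∀ ξ : ℝ × (Fin k → ℝ), ((gaussWeight (1 / ((n : ℝ) + 1)) ξ.1 *
          ∏ i, gaussWeight (1 / ((n : ℝ) + 1)) (ξ.2 i) : ℝ) : ℂ) *
        Complex.exp (Complex.I * ((-dotp x ξ - -dotp x' ξ : ℝ) : ℂ)) =
        ((gaussWeight (1 / ((n : ℝ) + 1)) ξ.1 : ℂ) *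
          Complex.exp (Complex.I * ((ξ.1 * (x'.1 - x.1) : ℝ) : ℂ))) *
        (((∏ i, gaussWeight (1 / ((n : ℝ) + 1)) (ξ.2 i) : ℝ) : ℂ) *
          Complex.exp (Complex.I * ((∑ i, ξ.2 i * (x'.2 i - x.2 i) : ℝ) : ℂ))) := by
      intro ξ
      have : -dotp x ξ - -dotp x' ξ =
          ξ.1 * (x'.1 - x.1) + ∑ i, ξ.2 i * (x'.2 i - x.2 i) := by
        simp only [dotp, mul_comm (ξ.2 _), sub_mul, Finset.sum_sub_distrib]
        ring
      rw [this, Complex.ofReal_add, mul_add, Complex.exp_add, Complex.ofReal_mul]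
      ring
    simp only [e1]
    have h := integral_prod_mul (μ := volume) (ν := volume)
      (fun s : ℝ => (gaussWeight (1 / ((n : ℝ) + 1)) s : ℂ) *
          Complex.exp (Complex.I * ((s * (x'.1 - x.1) : ℝ) : ℂ)))
      (fun y : Fin k → ℝ => ((∏ i, gaussWeight (1 / ((n : ℝ) + 1)) (y i) : ℝ) : ℂ) *
          Complex.exp (Complex.I * ((∑ i, y i * (x'.2 i - x.2 i) : ℝ) : ℂ)))
    rw [integral_gaussWeight_mul_exp (hb n), integral_prod_gaussWeight_mul_exp (hb n)] at h
    rw [Measure.volume_eq_prod, h, ← ofReal_norm, norm_mul, Complex.norm_real, Complex.norm_real,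
      Real.norm_of_nonneg (gaussKernel_nonneg _ _), Real.norm_of_nonneg (hprod _ _),
      ENNReal.ofReal_mul (gaussKernel_nonneg _ _), hneg _ x.1]
    simp only [fun i => hneg (1 / ((n : ℝ) + 1)) (x.2 i), le_refl]
  · intro n x
    have hk := lintegral_prod_gaussKernel_sub (ι := Fin k) (hb n) x.2
    rw [Fintype.card_fin] at hk
    have h1 : ∫⁻ a : ℝ, ENNReal.ofReal (gaussKernel (1 / ((n : ℝ) + 1)) (x.1 - a)) =
        ENNReal.ofReal (2 * Real.pi) := by
      rw [lintegral_sub_left_eq_self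
        (fun a => ENNReal.ofReal (gaussKernel (1 / ((n : ℝ) + 1)) a)),
        lintegral_gaussKernel (hb n)]
    have h := lintegral_prod_mul (μ := volume) (ν := volume)
      (f := fun a : ℝ => ENNReal.ofReal (gaussKernel (1 / ((n : ℝ) + 1)) (x.1 - a)))
      (g := fun y : Fin k → ℝ =>
        ENNReal.ofReal (∏ i, gaussKernel (1 / ((n : ℝ) + 1)) (x.2 i - y i)))
      (Measurable.aemeasurable (by fun_prop)) (Measurable.aemeasurable (by fun_prop))
    rw [h1, hk] at h
    exact h.le

theorem measurable_FT {u : ℝ × (Fin k → ℝ) → ℂ} (hu : Measurable u) : Measurable (FT u) := by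
  have h : Measurable fun r : (ℝ × (Fin k → ℝ)) × (ℝ × (Fin k → ℝ)) =>
      Complex.exp (-Complex.I * (dotp r.2 r.1 : ℂ)) * u r.2 := by fun_prop
  exact h.stronglyMeasurable.integral_prod_right'.measurable

theorem norm_FT_le (u : ℝ × (Fin k → ℝ) → ℂ) (ξ : ℝ × (Fin k → ℝ)) : ‖FT u ξ‖ ≤ ∫ x, ‖u x‖ := by
  refine (norm_integral_le_integral_norm _).trans (le_of_eq ?_)
  congr 1 with x
  rw [norm_mul, neg_mul, ← mul_neg, ← Complex.ofReal_neg, mul_comm Complex.I,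
    Complex.norm_exp_ofReal_mul_I, one_mul]

theorem norm_le_sqrt_nsq (ξ : ℝ × (Fin k → ℝ)) : ‖ξ‖ ≤ Real.sqrt (nsq ξ) := by
  have hs : 0 ≤ ∑ i, ξ.2 i ^ 2 := Finset.sum_nonneg fun i _ => sq_nonneg _
  refine norm_prod_le_iff.2 ⟨?_, (pi_norm_le_iff_of_nonneg (Real.sqrt_nonneg _)).2 fun i => ?_⟩
  · exact Real.abs_le_sqrt (by unfold nsq; linarith)
  · refine Real.abs_le_sqrt ?_
    have := Finset.single_le_sum (fun i _ => sq_nonneg (ξ.2 i)) (Finset.mem_univ i)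
    unfold nsq
    nlinarith [sq_nonneg ξ.1]

theorem integrable_FT_of_support {u : ℝ × (Fin k → ℝ) → ℂ} (hu : Measurable u) {lam : ℝ}
    (hs : ∀ ξ, ¬ inA lam ξ → FT u ξ = 0) : Integrable (FT u) := by
  have hsub : Function.support (FT u) ⊆ Metric.closedBall 0 (9 * lam / 4) := by
    intro ξ hξ
    have : inA lam ξ := by
      by_contra h
      exact hξ (hs ξ h)
    rw [mem_closedBall_zero_iff]
    exact (norm_le_sqrt_nsq ξ).trans this.2
  rw [← integrableOn_iff_integrable_of_support_subset hsub]
  exact Measure.integrableOn_of_bounded (M := ∫ x, ‖u x‖)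
    (isCompact_closedBall _ _).measure_lt_top.ne (measurable_FT hu).aestronglyMeasurable
    (ae_of_all _ (norm_FT_le u))

theorem mem_freqRange_of_inA_of_inCone {mu : ℝ} (hmu : 0 < mu) {ξ : ℝ × (Fin k → ℝ)}
    (hA : inA mu ξ) (hC : inCone ξ) : ξ.1 ∈ freqRange mu := by
  set S := ∑ i, ξ.2 i ^ 2 with hS
  have hs : 0 ≤ S := Finset.sum_nonneg fun i _ => sq_nonneg _
  have h1 : nsq ξ = ξ.1 ^ 2 + S := rfl
  have h2 := Real.sq_sqrt hs
  have h3 : Real.sqrt (nsq ξ) ^ 2 = ξ.1 ^ 2 + S := by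
    rw [Real.sq_sqrt (by rw [h1]; positivity), h1]
  have h4 : 100 * Real.sqrt S ≤ |ξ.1| := hC
  have h5 := Real.sqrt_nonneg S
  have h6 := Real.sqrt_nonneg (nsq ξ)
  have hup : |ξ.1| ≤ 9 * mu / 4 :=
    (Real.abs_le_sqrt (by rw [h1]; linarith)).trans hA.2
  have hlo : mu / 2 ≤ |ξ.1| := by
    have := hA.1
    refine abs_le_of_sq_le_sq' ?_ (abs_nonneg _) |>.2
    nlinarith [sq_abs ξ.1, abs_nonneg ξ.1]
  rcases le_total 0 ξ.1 with h | h
  · rw [abs_of_nonneg h] at *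
    exact Or.inl ⟨hlo, hup⟩
  · rw [abs_of_nonpos h] at *
    exact Or.inr ⟨by linarith, by linarith⟩

end Evolution

section WaveSchrodinger

variable {k : ℕ}

theorem enorm_add_sq_le (a b : ℂ) : ‖a + b‖ₑ ^ 2 ≤ 2 * (‖a‖ₑ ^ 2 + ‖b‖ₑ ^ 2) := by
  simp only [← ofReal_norm]
  rw [← ENNReal.ofReal_pow (norm_nonneg _), ← ENNReal.ofReal_pow (norm_nonneg _),
    ← ENNReal.ofReal_pow (norm_nonneg _), ← ENNReal.ofReal_add (by positivity) (by positivity),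
    ← ENNReal.ofReal_ofNat 2, ← ENNReal.ofReal_mul (by norm_num)]
  refine ENNReal.ofReal_le_ofReal ?_
  nlinarith [norm_add_le a b, norm_nonneg (a + b), sq_nonneg (‖a‖ - ‖b‖)]

theorem schrodingerEvol_eq (u : ℝ × (Fin k → ℝ) → ℂ) (t : ℝ) (x : ℝ × (Fin k → ℝ)) :
    schrodingerEvol u t x =
      ((2 * Real.pi) ^ (k + 1) : ℝ)⁻¹ • oscEvol (fun ξ => -nsq ξ) (FT u) t x := by
  unfold schrodingerEvol oscEvol
  congr 2 with ξ
  congr 2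
  push_cast
  ring

/-- The Fourier profile of the component of the wave evolution with phase `σ t |ξ|`. -/
def halfProfile (σ : ℝ) (f₀ f₁ : ℝ × (Fin k → ℝ) → ℂ) (ξ : ℝ × (Fin k → ℝ)) : ℂ :=
  (f₀ ξ - σ * Complex.I * (f₁ ξ / (Real.sqrt (nsq ξ) : ℂ))) / 2

@[fun_prop]
theorem measurable_halfProfile {σ : ℝ} {f₀ f₁ : ℝ × (Fin k → ℝ) → ℂ} (h₀ : Measurable f₀)
    (h₁ : Measurable f₁) : Measurable (halfProfile σ f₀ f₁) := by
  unfold halfProfile; fun_prop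

theorem norm_halfProfile_le {lam σ : ℝ} (hlam : 0 < lam) (hσ : |σ| = 1)
    {f₀ f₁ : ℝ × (Fin k → ℝ) → ℂ} (hs : ∀ ξ, ¬ inA lam ξ → f₁ ξ = 0) (ξ : ℝ × (Fin k → ℝ)) :
    ‖halfProfile σ f₀ f₁ ξ‖ ≤ ‖f₀ ξ‖ + lam⁻¹ * ‖f₁ ξ‖ := by
  have h1 : ‖f₁ ξ / (Real.sqrt (nsq ξ) : ℂ)‖ ≤ 9 / 8 * (lam⁻¹ * ‖f₁ ξ‖) := by
    by_cases h : inA lam ξ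
    · have hr : 0 < Real.sqrt (nsq ξ) := lt_of_lt_of_le (by positivity) h.1
      rw [norm_div, Complex.norm_real, Real.norm_of_nonneg hr.le, div_le_iff₀ hr]
      have h2 : 1 ≤ 9 / 8 * lam⁻¹ * Real.sqrt (nsq ξ) := by
        have := mul_le_mul_of_nonneg_left h.1 (by positivity : 0 ≤ 9 / 8 * lam⁻¹)
        refine le_trans (le_of_eq ?_) this
        field_simp
      nlinarith [norm_nonneg (f₁ ξ)]
    · simp [hs ξ h]
  have h2 : ‖(σ : ℂ) * Complex.I * (f₁ ξ / (Real.sqrt (nsq ξ) : ℂ))‖ =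
      ‖f₁ ξ / (Real.sqrt (nsq ξ) : ℂ)‖ := by
    rw [norm_mul, norm_mul, Complex.norm_real, Real.norm_eq_abs, hσ, Complex.norm_I]
    ring
  have h3 := norm_sub_le (f₀ ξ) ((σ : ℂ) * Complex.I * (f₁ ξ / (Real.sqrt (nsq ξ) : ℂ)))
  have h4 : 0 ≤ lam⁻¹ * ‖f₁ ξ‖ := by positivity
  rw [halfProfile, norm_div, RCLike.norm_ofNat]
  rw [h2] at h3
  linarith [norm_nonneg (f₀ ξ)]

theorem integrable_halfProfile {lam σ : ℝ} (hlam : 0 < lam) (hσ : |σ| = 1)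
    {f₀ f₁ : ℝ × (Fin k → ℝ) → ℂ} (hs : ∀ ξ, ¬ inA lam ξ → f₁ ξ = 0) (h₀ : Integrable f₀)
    (h₁ : Integrable f₁) (hm₀ : Measurable f₀) (hm₁ : Measurable f₁) :
    Integrable (halfProfile σ f₀ f₁) :=
  (h₀.norm.add (h₁.norm.const_mul lam⁻¹)).mono'
    (measurable_halfProfile hm₀ hm₁).aestronglyMeasurable
    (ae_of_all _ (norm_halfProfile_le hlam hσ hs))

theorem lintegral_halfProfile_sq_le {lam σ : ℝ} (hlam : 0 < lam) (hσ : |σ| = 1)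
    {f₀ f₁ : ℝ × (Fin k → ℝ) → ℂ} (hs : ∀ ξ, ¬ inA lam ξ → f₁ ξ = 0)
    (hm₀ : Measurable f₀) (hm₁ : Measurable f₁) :
    ∫⁻ ξ, ‖halfProfile σ f₀ f₁ ξ‖ₑ ^ 2 ≤
      2 * ((∫⁻ ξ, ‖f₀ ξ‖ₑ ^ 2) + ENNReal.ofReal (lam⁻¹ ^ 2) * ∫⁻ ξ, ‖f₁ ξ‖ₑ ^ 2) := by
  rw [← lintegral_const_mul _ (hm₁.enorm.pow_const 2),
    ← lintegral_add_left (hm₀.enorm.pow_const 2), ← lintegral_const_mul _ (by fun_prop)]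
  refine lintegral_mono fun ξ => ?_
  have h := norm_halfProfile_le (f₀ := f₀) hlam hσ hs ξ
  simp only [← ofReal_norm]
  rw [← ENNReal.ofReal_pow (norm_nonneg _), ← ENNReal.ofReal_pow (norm_nonneg _),
    ← ENNReal.ofReal_pow (norm_nonneg _), ← ENNReal.ofReal_mul (by positivity),
    ← ENNReal.ofReal_add (by positivity) (by positivity),
    ← ENNReal.ofReal_ofNat 2, ← ENNReal.ofReal_mul (by norm_num)]
  refine ENNReal.ofReal_le_ofReal ((pow_le_pow_left₀ (norm_nonneg _) h 2).trans ?_)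
  nlinarith [sq_nonneg (‖f₀ ξ‖ - lam⁻¹ * ‖f₁ ξ‖)]

theorem integrable_exp_mul {f : ℝ × (Fin k → ℝ) → ℂ} (hf : Integrable f)
    {θ : ℝ × (Fin k → ℝ) → ℝ} (hθ : Measurable θ) :
    Integrable fun ξ => Complex.exp (Complex.I * (θ ξ : ℂ)) * f ξ := by
  refine hf.bdd_mul (c := 1) (by fun_prop : Measurable fun ξ =>
    Complex.exp (Complex.I * (θ ξ : ℂ))).aestronglyMeasurable (ae_of_all _ fun ξ => ?_)
  rw [mul_comm, Complex.norm_exp_ofReal_mul_I]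

theorem waveEvol_eq {u₀ u₁ : ℝ × (Fin k → ℝ) → ℂ}
    (hp : Integrable (halfProfile 1 (FT u₀) (FT u₁)))
    (hm : Integrable (halfProfile (-1) (FT u₀) (FT u₁))) (t : ℝ) (x : ℝ × (Fin k → ℝ)) :
    waveEvol u₀ u₁ t x = ((2 * Real.pi) ^ (k + 1) : ℝ)⁻¹ •
      (oscEvol (fun ξ => 1 * Real.sqrt (nsq ξ)) (halfProfile 1 (FT u₀) (FT u₁)) t x +
        oscEvol (fun ξ => -1 * Real.sqrt (nsq ξ)) (halfProfile (-1) (FT u₀) (FT u₁)) t x) := by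
  unfold waveEvol oscEvol
  rw [← integral_add (integrable_exp_mul hp (by fun_prop)) (integrable_exp_mul hm (by fun_prop))]
  congr 2 with ξ
  set r := Real.sqrt (nsq ξ)
  have e1 : Complex.exp (Complex.I * ((dotp x ξ + t * (1 * r) : ℝ) : ℂ)) =
      Complex.exp (Complex.I * (dotp x ξ : ℂ)) *
        (Complex.cos (t * r) + Complex.sin (t * r) * Complex.I) := by
    rw [← Complex.exp_mul_I, ← Complex.exp_add]
    congr 1; push_cast; ring
  have e2 : Complex.exp (Complex.I * ((dotp x ξ + t * (-1 * r) : ℝ) : ℂ)) =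
      Complex.exp (Complex.I * (dotp x ξ : ℂ)) *
        (Complex.cos (t * r) - Complex.sin (t * r) * Complex.I) := by
    have := Complex.exp_mul_I (-(t * r : ℂ))
    rw [Complex.cos_neg, Complex.sin_neg, neg_mul (Complex.sin _), ← sub_eq_add_neg] at this
    rw [← this, ← Complex.exp_add]
    congr 1; push_cast; ring
  rw [e1, e2]
  simp only [halfProfile]
  push_cast
  linear_combination (Complex.exp (Complex.I * (dotp x ξ : ℂ)) * Complex.sin (t * r) *
    (FT u₁ ξ / (r : ℂ))) * Complex.I_sq

theorem enorm_integral_wave_schrodinger_le {lam mu : ℝ} (hlam : 1 ≤ lam) (hmu : 2 ≤ mu)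
    {u₀ u₁ v : ℝ × (Fin k → ℝ) → ℂ} (hu₀ : Integrable u₀) (hu₁ : Integrable u₁)
    (hv : Integrable v) (hu₀m : Measurable u₀) (hu₁m : Measurable u₁) (hvm : Measurable v)
    (hs₀ : ∀ ξ, ¬ inA lam ξ → FT u₀ ξ = 0) (hs₁ : ∀ ξ, ¬ inA lam ξ → FT u₁ ξ = 0)
    (hsv : ∀ ξ, ¬ (inA mu ξ ∧ inCone ξ) → FT v ξ = 0) (s : Set ℝ) :
    ‖∫ t in s, ∫ x₁ : ℝ, (∫ y : Fin k → ℝ, (waveEvol u₀ u₁ t (x₁, y)).re ^ 2) *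
        ∫ y : Fin k → ℝ, ‖schrodingerEvol v t (x₁, y)‖ ^ 2‖ₑ ≤
      8 * (‖((2 * Real.pi) ^ (k + 1) : ℝ)⁻¹‖ₑ ^ 2) ^ 2 *
        ENNReal.ofReal (2 * ((2 * Real.pi) ^ k * ((2 * Real.pi) ^ k *
          (2 * Real.pi * (16 * Real.pi / mu))))) *
        ENNReal.ofReal (2 * (2 * Real.pi * (2 * Real.pi) ^ k)) ^ 2 *
        ((∫⁻ x, ‖v x‖ₑ ^ 2) *
          ((∫⁻ x, ‖u₀ x‖ₑ ^ 2) + ENNReal.ofReal (lam⁻¹ ^ 2) * ∫⁻ x, ‖u₁ x‖ₑ ^ 2)) := by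
  have hlam0 : 0 < lam := by linarith
  have hmu0 : 0 < mu := by linarith
  have hf₀ := integrable_FT_of_support hu₀m hs₀
  have hf₁ := integrable_FT_of_support hu₁m hs₁
  have hg := integrable_FT_of_support (lam := mu) hvm fun ξ h => hsv ξ fun h' => h h'.1
  have hf₀m := measurable_FT hu₀m
  have hf₁m := measurable_FT hu₁m
  have hgm := measurable_FT hvm
  have hgs : ∀ ξ : ℝ × (Fin k → ℝ), ξ.1 ∉ freqRange mu → FT v ξ = 0 := fun ξ h =>
    hsv ξ fun h' => h (mem_freqRange_of_inA_of_inCone hmu0 h'.1 h'.2)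
  have a1 : |(1 : ℝ)| = 1 := abs_one
  have a2 : |(-1 : ℝ)| = 1 := by simp
  have hp := integrable_halfProfile hlam0 a1 hs₁ hf₀ hf₁ hf₀m hf₁m
  have hm := integrable_halfProfile hlam0 a2 hs₁ hf₀ hf₁ hf₀m hf₁m
  have hpm : Measurable (halfProfile 1 (FT u₀) (FT u₁)) := measurable_halfProfile hf₀m hf₁m
  have hmm : Measurable (halfProfile (-1) (FT u₀) (FT u₁)) := measurable_halfProfile hf₀m hf₁m
  set c : ℝ := ((2 * Real.pi) ^ (k + 1) : ℝ)⁻¹ with hc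
  set P := transMass (fun ξ => 1 * Real.sqrt (nsq ξ)) (halfProfile 1 (FT u₀) (FT u₁)) with hP
  set N := transMass (fun ξ => -1 * Real.sqrt (nsq ξ)) (halfProfile (-1) (FT u₀) (FT u₁)) with hN
  set G := transMass (fun ξ => -nsq ξ) (FT v) with hG
  have hPm : Measurable P := measurable_transMass (by fun_prop) hpm
  have hNm : Measurable N := measurable_transMass (by fun_prop) hmm
  have hGm : Measurable G := measurable_transMass (by fun_prop) hgm
  have hw : ∀ t x₁ : ℝ, ‖∫ y : Fin k → ℝ, (waveEvol u₀ u₁ t (x₁, y)).re ^ 2‖ₑ ≤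
      ‖c‖ₑ ^ 2 * (2 * (P (t, x₁) + N (t, x₁))) := by
    intro t x₁
    have m1 : Measurable fun y : Fin k → ℝ => ‖oscEvol (fun ξ => 1 * Real.sqrt (nsq ξ))
        (halfProfile 1 (FT u₀) (FT u₁)) t (x₁, y)‖ₑ ^ 2 :=
      ((measurable_oscEvol (by fun_prop) hpm).comp
        (f := fun y : Fin k → ℝ => (t, (x₁, y))) (by fun_prop)).enorm.pow_const 2
    have m2 : Measurable fun y : Fin k → ℝ => ‖oscEvol (fun ξ => -1 * Real.sqrt (nsq ξ))
        (halfProfile (-1) (FT u₀) (FT u₁)) t (x₁, y)‖ₑ ^ 2 :=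
      ((measurable_oscEvol (by fun_prop) hmm).comp
        (f := fun y : Fin k → ℝ => (t, (x₁, y))) (by fun_prop)).enorm.pow_const 2
    refine (enorm_integral_le_lintegral_enorm _).trans ?_
    simp only [hP, hN, transMass]
    rw [← lintegral_add_left m1, ← lintegral_const_mul' _ _ ENNReal.ofNat_ne_top,
      ← lintegral_const_mul' _ _ (by simp)]
    refine lintegral_mono fun y => ?_
    have h1 : ‖(waveEvol u₀ u₁ t (x₁, y)).re ^ 2‖ₑ ≤ ‖waveEvol u₀ u₁ t (x₁, y)‖ₑ ^ 2 := by
      rw [enorm_pow]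
      gcongr
      simp only [← ofReal_norm]
      exact ENNReal.ofReal_le_ofReal (Complex.abs_re_le_norm _)
    refine h1.trans ?_
    rw [waveEvol_eq hp hm, enorm_smul, mul_pow]
    gcongr
    exact enorm_add_sq_le _ _
  have hE : ∀ t x₁ : ℝ, ‖∫ y : Fin k → ℝ, ‖schrodingerEvol v t (x₁, y)‖ ^ 2‖ₑ ≤
      ‖c‖ₑ ^ 2 * G (t, x₁) := by
    intro t x₁
    have m1 : Measurable fun y : Fin k → ℝ => ‖oscEvol (fun ξ => -nsq ξ) (FT v) t (x₁, y)‖ₑ ^ 2 :=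
      ((measurable_oscEvol (by fun_prop) hgm).comp
        (f := fun y : Fin k → ℝ => (t, (x₁, y))) (by fun_prop)).enorm.pow_const 2
    refine (enorm_integral_le_lintegral_enorm _).trans ?_
    simp only [hG, transMass]
    rw [← lintegral_const_mul _ m1]
    refine lintegral_mono fun y => ?_
    rw [enorm_pow, enorm_norm, schrodingerEvol_eq, enorm_smul, mul_pow]
  have hPG := lintegral_transMass_mul_le hmu a1.le hg hp hgm hpm hgs
  have hNG := lintegral_transMass_mul_le hmu a2.le hg hm hgm hmm hgs
  rw [← hP, ← hG] at hPG
  rw [← hN, ← hG] at hNG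
  have hp2 := lintegral_halfProfile_sq_le (f₀ := FT u₀) hlam0 a1 hs₁ hf₀m hf₁m
  have hm2 := lintegral_halfProfile_sq_le (f₀ := FT u₀) hlam0 a2 hs₁ hf₀m hf₁m
  have hb₀ := lintegral_FT_sq_le hu₀
  have hb₁ := lintegral_FT_sq_le hu₁
  have hbv := lintegral_FT_sq_le hv
  set B := ENNReal.ofReal (2 * ((2 * Real.pi) ^ k * ((2 * Real.pi) ^ k *
          (2 * Real.pi * (16 * Real.pi / mu)))))
  set M := ENNReal.ofReal (2 * (2 * Real.pi * (2 * Real.pi) ^ k))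
  set Λ := ENNReal.ofReal (lam⁻¹ ^ 2)
  have hPGm : Measurable fun q => P q * G q := hPm.mul hGm
  have hjm : Measurable fun q : ℝ × ℝ => P q * G q + N q * G q :=
    hPGm.add (hNm.mul hGm)
  have hQ : ‖∫ t in s, ∫ x₁ : ℝ, (∫ y : Fin k → ℝ, (waveEvol u₀ u₁ t (x₁, y)).re ^ 2) *
        ∫ y : Fin k → ℝ, ‖schrodingerEvol v t (x₁, y)‖ ^ 2‖ₑ ≤
      2 * (‖c‖ₑ ^ 2) ^ 2 * ∫⁻ q, (P q * G q + N q * G q) := by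
    rw [Measure.volume_eq_prod, lintegral_prod _ hjm.aemeasurable,
      ← lintegral_const_mul _ hjm.lintegral_prod_right']
    refine (enorm_integral_le_lintegral_enorm _).trans ((setLIntegral_le_lintegral _ _).trans
      (lintegral_mono fun t => (enorm_integral_le_lintegral_enorm _).trans ?_))
    rw [← lintegral_const_mul' _ _ (by simp [ENNReal.mul_eq_top])]
    refine lintegral_mono fun x₁ => ?_
    rw [enorm_mul]
    refine (mul_le_mul' (hw t x₁) (hE t x₁)).trans (le_of_eq ?_)
    ring
  refine hQ.trans ?_
  rw [lintegral_add_left hPGm]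
  calc _ ≤ 2 * (‖c‖ₑ ^ 2) ^ 2 * (B * ((M * ∫⁻ x, ‖v x‖ₑ ^ 2) * (2 * ((M * ∫⁻ x, ‖u₀ x‖ₑ ^ 2) +
          Λ * (M * ∫⁻ x, ‖u₁ x‖ₑ ^ 2)))) + B * ((M * ∫⁻ x, ‖v x‖ₑ ^ 2) *
          (2 * ((M * ∫⁻ x, ‖u₀ x‖ₑ ^ 2) + Λ * (M * ∫⁻ x, ‖u₁ x‖ₑ ^ 2))))) := by
        gcongr 2 * (‖c‖ₑ ^ 2) ^ 2 * (?_ + ?_)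
        · refine hPG.trans ?_
          gcongr
          refine hp2.trans ?_
          gcongr
        · refine hNG.trans ?_
          gcongr
          refine hm2.trans ?_
          gcongr
    _ = _ := by ring

theorem hasTemperateGrowth_volume :
    (volume : Measure (ℝ × (Fin k → ℝ))).HasTemperateGrowth := by
  have : (volume : Measure (ℝ × (Fin k → ℝ))).IsAddHaarMeasure :=
    inferInstanceAs ((volume.prod volume).IsAddHaarMeasure)
  infer_instance

theorem SchwartzMap.lintegral_enorm_sq {E : Type*} [NormedAddCommGroup E] [NormedSpace ℝ E]
    (u : SchwartzMap (ℝ × (Fin k → ℝ)) E) :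
    ∫⁻ x, ‖u x‖ₑ ^ 2 = ENNReal.ofReal (∫ x, ‖u x‖ ^ 2) := by
  have := hasTemperateGrowth_volume (k := k)
  have h : Integrable fun x => ‖u x‖ ^ 2 := by
    have := (u.memLp 2 (μ := volume)).integrable_norm_pow (by norm_num)
    simpa using this
  rw [ofReal_integral_eq_lintegral_ofReal h (ae_of_all _ fun x => by positivity)]
  refine lintegral_congr fun x => ?_
  rw [← ofReal_norm, ENNReal.ofReal_pow (norm_nonneg _)]

end WaveSchrodinger

/-- **Bilinear wave–Schrödinger estimate, low-high interaction (for `n`).** For every dimension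
`d = k + 1 ≥ 2` there are `C > 0` and `μ₀ ≥ 1` such that for `λ ≥ 1`, `μ ≥ μ₀`, wave data
`(n₀, n₁)` with Fourier support in `A_λ` and Schrödinger datum `E₀` with Fourier support in
`A_μ ∩ {|ξ₁| ≥ 100|ξ'|}`, for all `T > 0`:
`‖ ‖n‖_{L²_y} ‖E‖_{L²_y} ‖_{L²_{t,x₁}} ≤ C μ^{-1/2} ‖E₀‖_{L²} (‖n₀‖_{L²} + λ⁻¹‖n₁‖_{L²})`. -/
theorem bilinear_low_high_n (k : ℕ) (hk : 1 ≤ k) :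
    ∃ C : ℝ, 0 < C ∧ ∃ μ₀ : ℝ, 1 ≤ μ₀ ∧
      ∀ (lam mu : ℝ), 1 ≤ lam → μ₀ ≤ mu →
      ∀ (n₀ n₁ : SchwartzMap (ℝ × (Fin k → ℝ)) ℝ) (E₀ : SchwartzMap (ℝ × (Fin k → ℝ)) ℂ),
        (∀ ξ : ℝ × (Fin k → ℝ), ¬ inA lam ξ → FT (fun z => (n₀ z : ℂ)) ξ = 0) →
        (∀ ξ : ℝ × (Fin k → ℝ), ¬ inA lam ξ → FT (fun z => (n₁ z : ℂ)) ξ = 0) →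
        (∀ ξ : ℝ × (Fin k → ℝ), ¬ (inA mu ξ ∧ inCone ξ) → FT (⇑E₀) ξ = 0) →
        ∀ T : ℝ, 0 < T →
        (∫ t in Set.Icc (0:ℝ) T, ∫ x₁ : ℝ,
            (∫ y : Fin k → ℝ,
              ((waveEvol (fun z => (n₀ z : ℂ)) (fun z => (n₁ z : ℂ)) t (x₁, y)).re) ^ 2) *
            (∫ y : Fin k → ℝ, ‖schrodingerEvol (⇑E₀) t (x₁, y)‖ ^ 2)) ^ ((1:ℝ)/2) ≤
          C * mu ^ (-(1:ℝ)/2) * (∫ x : ℝ × (Fin k → ℝ), ‖E₀ x‖ ^ 2) ^ ((1:ℝ)/2) *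
            ((∫ x : ℝ × (Fin k → ℝ), (n₀ x) ^ 2) ^ ((1:ℝ)/2) +
              lam⁻¹ * (∫ x : ℝ × (Fin k → ℝ), (n₁ x) ^ 2) ^ ((1:ℝ)/2)) := by
  have hpi := Real.pi_pos
  set c : ℝ := ((2 * Real.pi) ^ (k + 1) : ℝ)⁻¹ with hc
  have hc0 : 0 < c := by positivity
  set P : ℝ := (2 * Real.pi) ^ k with hP
  have hP0 : 0 < P := by positivity
  set M : ℝ := 2 * (2 * Real.pi * P) with hM
  have hM0 : 0 < M := by positivity
  set D : ℝ := 8 * (c ^ 2) ^ 2 * (2 * (P * (P * (2 * Real.pi * (16 * Real.pi))))) * M ^ 2 with hD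
  have hD0 : 0 < D := by positivity
  refine ⟨Real.sqrt D, Real.sqrt_pos.2 hD0, 2, by norm_num, ?_⟩
  intro lam mu hlam hmu n₀ n₁ E₀ hn₀ hn₁ hE T _
  have hlam0 : 0 < lam := by linarith
  have hmu0 : 0 < mu := by linarith
  have := hasTemperateGrowth_volume (k := k)
  have h := enorm_integral_wave_schrodinger_le (u₀ := fun z => (n₀ z : ℂ))
    (u₁ := fun z => (n₁ z : ℂ)) hlam hmu n₀.integrable.ofReal n₁.integrable.ofReal
    E₀.integrable (Complex.measurable_ofReal.comp n₀.continuous.measurable)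
    (Complex.measurable_ofReal.comp n₁.continuous.measurable) E₀.continuous.measurable hn₀ hn₁ hE
    (Set.Icc 0 T)
  have hn : ∀ n : SchwartzMap (ℝ × (Fin k → ℝ)) ℝ, ∫⁻ x, ‖(n x : ℂ)‖ₑ ^ 2 =
      ENNReal.ofReal (∫ x, n x ^ 2) := by
    intro n
    have := n.lintegral_enorm_sq
    simp only [Real.norm_eq_abs, sq_abs] at this
    rw [← this]
    simp only [← ofReal_norm, Complex.norm_real]
  set Q := ∫ t in Set.Icc (0:ℝ) T, ∫ x₁ : ℝ,
            (∫ y : Fin k → ℝ,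
              ((waveEvol (fun z => (n₀ z : ℂ)) (fun z => (n₁ z : ℂ)) t (x₁, y)).re) ^ 2) *
            (∫ y : Fin k → ℝ, ‖schrodingerEvol (⇑E₀) t (x₁, y)‖ ^ 2) with hQ
  have hQ0 : 0 ≤ Q := integral_nonneg fun t => integral_nonneg fun x => mul_nonneg
    (integral_nonneg fun y => sq_nonneg _) (integral_nonneg fun y => sq_nonneg _)
  change ‖Q‖ₑ ≤ _ at h
  rw [hn, hn, E₀.lintegral_enorm_sq, ← hc, ← hP, ← hM] at h
  set a := ∫ x : ℝ × (Fin k → ℝ), (n₀ x) ^ 2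
  set b := ∫ x : ℝ × (Fin k → ℝ), (n₁ x) ^ 2
  set e := ∫ x : ℝ × (Fin k → ℝ), ‖E₀ x‖ ^ 2
  have ha : 0 ≤ a := integral_nonneg fun x => sq_nonneg _
  have hb : 0 ≤ b := integral_nonneg fun x => sq_nonneg _
  have he : 0 ≤ e := integral_nonneg fun x => sq_nonneg _
  have hQle : Q ≤ D / mu * (e * (a + lam⁻¹ ^ 2 * b)) := by
    rw [Real.enorm_of_nonneg hQ0, Real.enorm_of_nonneg hc0.le, ← ENNReal.ofReal_ofNat 8,
      ← ENNReal.ofReal_pow hc0.le, ← ENNReal.ofReal_pow (by positivity),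
      ← ENNReal.ofReal_pow hM0.le, ← ENNReal.ofReal_mul (by positivity),
      ← ENNReal.ofReal_mul (by positivity), ← ENNReal.ofReal_mul (by positivity),
      ← ENNReal.ofReal_mul (by positivity), ← ENNReal.ofReal_add ha (by positivity),
      ← ENNReal.ofReal_mul he, ← ENNReal.ofReal_mul (by positivity),
      ENNReal.ofReal_le_ofReal_iff (by positivity)] at h
    refine h.trans (le_of_eq ?_)
    rw [hD]
    ring
  have hmu' : mu ^ (-(1:ℝ) / 2) = (Real.sqrt mu)⁻¹ := by
    rw [Real.sqrt_eq_rpow, ← Real.rpow_neg hmu0.le]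
    norm_num
  rw [hmu']
  simp only [← Real.sqrt_eq_rpow]
  rw [Real.sqrt_le_iff]
  refine ⟨by positivity, hQle.trans ?_⟩
  have h1 : (Real.sqrt D * (Real.sqrt mu)⁻¹ * Real.sqrt e *
      (Real.sqrt a + lam⁻¹ * Real.sqrt b)) ^ 2 =
      D / mu * (e * (Real.sqrt a + lam⁻¹ * Real.sqrt b) ^ 2) := by
    rw [mul_pow, mul_pow, mul_pow, inv_pow, Real.sq_sqrt hD0.le, Real.sq_sqrt hmu0.le,
      Real.sq_sqrt he]
    ring
  rw [h1]
  gcongr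
  have h2 : 0 ≤ lam⁻¹ * (Real.sqrt a * Real.sqrt b) := by positivity
  nlinarith [Real.sq_sqrt ha, Real.sq_sqrt hb]
end
end
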